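/- Let H be a ribbon Hopf G-bialgebra with Drinfeld element u_α^{-α} = Σ_i S_{-α}^{α/2}((R''_i)_{-α}^{α/2})(R'_i)_α^{-α/2} ∈ H_α^0 and ribbon element v, and define the pivotal element g_α = u_α^{-α}(v^{-1})_α^α. Then g is grouplike: Δ_{α,β}^0(g_{α+β}) = g_α ⊗ g_β and ε^0(g_0) = 1. -/

import Mathlib

open TensorProduct

/-- A Hopf `G`-bialgebra (De Renzi–Martel–Wang), modeled inside an ambient `k`-vector space
`A` containing all the components `H α β`.  The structure operations are given as global
linear maps, and the axioms (H1)–(H9) are required on graded elements. -/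
structure HopfGBialgebra (k : Type*) (G : Type*) [Field k] [AddCommGroup G] where
  /-- ambient vector space -/
  A : Type*
  [addCommGroup : AddCommGroup A]
  [module : Module k A]
  /-- the components `H α β` -/
  H : G → G → Submodule k A
  /-- product `μ` -/
  mul : A →ₗ[k] A →ₗ[k] A
  /-- units `η_α(1) = 1_α` -/
  one : G → A
  /-- coproducts `Δ_{α,β}` -/
  comul : G → G → A →ₗ[k] A ⊗[k] A
  /-- counits `ε^β` -/
  counit : G → A →ₗ[k] k
  /-- antipodes `S_α^β` -/
  S : G → G → A →ₗ[k] A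
  mul_mem : ∀ {α β γ : G} {x y : A}, x ∈ H α β → y ∈ H α γ → mul x y ∈ H α (β + γ)
  one_mem : ∀ α : G, one α ∈ H α 0
  comul_mem : ∀ {α β γ : G} {x : A}, x ∈ H (α + β) γ →
    comul α β x ∈ LinearMap.range (TensorProduct.map (H α γ).subtype (H β γ).subtype)
  S_mem : ∀ {α β : G} {x : A}, x ∈ H α β → S α β x ∈ H (-α) (-β)
  /-- (H1) associativity -/
  mul_assoc' : ∀ {α β γ δ : G} {x y z : A}, x ∈ H α β → y ∈ H α γ → z ∈ H α δ →
    mul (mul x y) z = mul x (mul y z)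
  /-- (H2) unitality -/
  one_mul' : ∀ {α β : G} {x : A}, x ∈ H α β → mul (one α) x = x
  mul_one' : ∀ {α β : G} {x : A}, x ∈ H α β → mul x (one α) = x
  /-- (H3) coassociativity -/
  coassoc : ∀ (α β γ δ : G) (x : A), x ∈ H (α + β + γ) δ →
    (TensorProduct.assoc k A A A)
        ((TensorProduct.map (comul α β) LinearMap.id) (comul (α + β) γ x)) =
      (TensorProduct.map LinearMap.id (comul β γ)) (comul α (β + γ) x)
  /-- (H4) counitality -/
  counit_comul : ∀ (α β : G) (x : A), x ∈ H α β →
    (TensorProduct.lid k A) ((TensorProduct.map (counit β) LinearMap.id) (comul 0 α x)) = x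
  comul_counit : ∀ (α β : G) (x : A), x ∈ H α β →
    (TensorProduct.rid k A) ((TensorProduct.map LinearMap.id (counit β)) (comul α 0 x)) = x
  /-- (H5) compatibility of product and coproduct -/
  comul_mul : ∀ (α β γ δ : G) (x y : A), x ∈ H (α + β) γ → y ∈ H (α + β) δ →
    comul α β (mul x y) =
      (TensorProduct.map (TensorProduct.lift mul) (TensorProduct.lift mul))
        ((TensorProduct.tensorTensorTensorComm k A A A A) (comul α β x ⊗ₜ[k] comul α β y))
  /-- (H6) -/
  counit_mul : ∀ (α β : G) (x y : A), x ∈ H 0 α → y ∈ H 0 β →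
    counit (α + β) (mul x y) = counit α x * counit β y
  /-- (H7) -/
  comul_one : ∀ α β : G, comul α β (one (α + β)) = one α ⊗ₜ[k] one β
  /-- (H8) -/
  counit_one : counit 0 (one 0) = 1
  /-- (H9) antipode axiom -/
  antipode_left : ∀ (α β : G) (x : A), x ∈ H 0 β →
    TensorProduct.lift mul ((TensorProduct.map (S (-α) β) LinearMap.id) (comul (-α) α x)) =
      counit β x • one α
  antipode_right : ∀ (α β : G) (x : A), x ∈ H 0 β →
    TensorProduct.lift mul ((TensorProduct.map LinearMap.id (S (-α) β)) (comul α (-α) x)) =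
      counit β x • one α

attribute [instance] HopfGBialgebra.addCommGroup HopfGBialgebra.module

/-- The componentwise product on a tensor product of two (nonunital) algebra-like modules,
`(x ⊗ y) · (x' ⊗ y') = (x x') ⊗ (y y')`. -/
noncomputable def tmulMul {k M N : Type*} [Field k] [AddCommGroup M] [Module k M]
    [AddCommGroup N] [Module k N]
    (p : M →ₗ[k] M →ₗ[k] M) (q : N →ₗ[k] N →ₗ[k] N) :
    (M ⊗[k] N) →ₗ[k] (M ⊗[k] N) →ₗ[k] M ⊗[k] N :=
  TensorProduct.curry ((TensorProduct.map (TensorProduct.lift p) (TensorProduct.lift q)) ∘ₗ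
    (TensorProduct.tensorTensorTensorComm k M N M N).toLinearMap)

/-- The Drinfeld element `u = Σ_i S(R''_i) R'_i` associated with a product, an antipode
component and an R-matrix component. -/
noncomputable def drinfeldAux {k A : Type*} [Field k] [AddCommGroup A] [Module k A]
    (mul : A →ₗ[k] A →ₗ[k] A) (S : A →ₗ[k] A) (Rm : A ⊗[k] A) : A :=
  TensorProduct.lift mul ((TensorProduct.map S LinearMap.id) ((TensorProduct.comm k A A) Rm))

/-- A ribbon Hopf `G`-bialgebra: a Hopf `G`-bialgebra over a commutative ring `G` with `2`
invertible, together with an invertible R-matrix `R_{α,β} ∈ H_α^{β/2} ⊗ H_β^{α/2}`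
satisfying (R1)–(R3), an invertible central ribbon element `v_α ∈ Z(H_α^{-α})`
satisfying (R4)–(R7), and the (automatically invertible) antipode's inverse. -/
structure RibbonHopfGBialgebra (k : Type*) (G : Type*) [Field k] [CommRing G]
    [Invertible (2 : G)] extends HopfGBialgebra k G where
  /-- the R-matrix `R_{α,β}` -/
  R : G → G → A ⊗[k] A
  R_mem : ∀ α β : G, R α β ∈ LinearMap.range
    (TensorProduct.map (H α (⅟(2 : G) * β)).subtype (H β (⅟(2 : G) * α)).subtype)
  /-- inverse of the R-matrix in `H_α^⊕ ⊗ H_β^⊕` -/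
  Rinv : G → G → A ⊗[k] A
  R_Rinv : ∀ α β : G, tmulMul mul mul (R α β) (Rinv α β) = one α ⊗ₜ[k] one β
  Rinv_R : ∀ α β : G, tmulMul mul mul (Rinv α β) (R α β) = one α ⊗ₜ[k] one β
  /-- (R1): `R · Δ_{α,β}(x) = τ(Δ_{β,α}(x)) · R` -/
  R_comul : ∀ (α β γ : G) (x : A), x ∈ H (α + β) γ →
    tmulMul mul mul (R α β) (comul α β x) =
      tmulMul mul mul ((TensorProduct.comm k A A) (comul β α x)) (R α β)
  /-- (R2): `(id ⊗ Δ_{β,γ})(R_{α,β+γ}) = (R_{α,γ})_{13} (R_{α,β})_{12}` -/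
  comul_R_right : ∀ α β γ : G,
    (TensorProduct.map LinearMap.id (comul β γ)) (R α (β + γ)) =
      (TensorProduct.map (TensorProduct.lift mul) (TensorProduct.comm k A A).toLinearMap)
        ((TensorProduct.tensorTensorTensorComm k A A A A) (R α γ ⊗ₜ[k] R α β))
  /-- (R3): `(Δ_{α,β} ⊗ id)(R_{α+β,γ}) = (R_{α,γ})_{13} (R_{β,γ})_{23}` -/
  comul_R_left : ∀ α β γ : G,
    (TensorProduct.map (comul α β) LinearMap.id) (R (α + β) γ) =
      (TensorProduct.map LinearMap.id (TensorProduct.lift mul))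
        ((TensorProduct.tensorTensorTensorComm k A A A A) (R α γ ⊗ₜ[k] R β γ))
  /-- the ribbon element `v_α ∈ H_α^{-α}` -/
  v : G → A
  v_mem : ∀ α : G, v α ∈ H α (-α)
  v_central : ∀ (α β : G) (x : A), x ∈ H α β → mul (v α) x = mul x (v α)
  /-- inverse of the ribbon element -/
  vinv : G → A
  vinv_mem : ∀ α : G, vinv α ∈ H α α
  v_vinv : ∀ α : G, mul (v α) (vinv α) = one α
  vinv_v : ∀ α : G, mul (vinv α) (v α) = one α
  /-- (R4): `v² = u S(u)` where `u` is the Drinfeld element -/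
  v_sq : ∀ α : G, mul (v α) (v α) =
    mul (drinfeldAux mul (S (-α) (⅟(2 : G) * α)) (R α (-α)))
      (S (-α) α (drinfeldAux mul (S α (⅟(2 : G) * (-α))) (R (-α) α)))
  /-- (R5): formula for `Δ_{α,β}(v_{α+β})` -/
  comul_v : ∀ α β : G,
    comul α β (v (α + β)) =
      (TensorProduct.map
        ((mul (v α)) ∘ₗ (TensorProduct.lift mul) ∘ₗ
          (TensorProduct.map (S (-α) (⅟(2 : G) * β)) LinearMap.id))
        ((mul (v β)) ∘ₗ (TensorProduct.lift mul) ∘ₗ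
          (TensorProduct.map LinearMap.id (S (-β) (⅟(2 : G) * α)))))
        ((TensorProduct.tensorTensorTensorComm k A A A A)
          (R (-α) β ⊗ₜ[k] (TensorProduct.comm k A A) (R (-β) α)))
  /-- (R6) -/
  counit_v : counit 0 (v 0) = 1
  /-- (R7) -/
  S_v : ∀ α : G, S α (-α) (v α) = v (-α)
  /-- the inverse of the antipode (the antipode of a ribbon Hopf `G`-bialgebra is
  invertible) -/
  Sinv : G → G → A →ₗ[k] A
  Sinv_S : ∀ (α β : G) (x : A), x ∈ H α β → Sinv α β (S α β x) = x
  S_Sinv : ∀ (α β : G) (x : A), x ∈ H (-α) (-β) → S α β (Sinv α β x) = x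

namespace PivAux
open TensorProduct

section ev
variable {k M N Q P : Type*} [Field k] [AddCommGroup M] [Module k M] [AddCommGroup N] [Module k N]
  [AddCommGroup Q] [Module k Q] [AddCommGroup P] [Module k P]

/-- Sweedler-style evaluation of a function on a chosen representation of a tensor. -/
noncomputable def ev (t : M ⊗[k] N) (f : M → N → P) : P :=
  ∑ i ∈ (TensorProduct.exists_finset t).choose, f i.1 i.2

theorem ev_tmul (t : M ⊗[k] N) : ev t (fun a b => a ⊗ₜ[k] b) = t :=
  (TensorProduct.exists_finset t).choose_spec.symm

theorem ev_lin (L : M ⊗[k] N →ₗ[k] P) (t : M ⊗[k] N) :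
    ev t (fun a b => L (a ⊗ₜ[k] b)) = L t := by
  conv_rhs => rw [← ev_tmul t]
  simp [ev, map_sum]

theorem ev_congr (t : M ⊗[k] N) {f g : M → N → P} (h : ∀ a b, f a b = g a b) :
    ev t f = ev t g := Finset.sum_congr rfl fun _ _ => h _ _

theorem ev_swap {M' N' : Type*} [AddCommGroup M'] [Module k M'] [AddCommGroup N'] [Module k N']
    (t : M ⊗[k] N) (s : M' ⊗[k] N') (f : M → N → M' → N' → P) :
    ev t (fun a b => ev s (fun c d => f a b c d)) =
      ev s (fun c d => ev t (fun a b => f a b c d)) := Finset.sum_comm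

theorem map_ev {P' : Type*} [AddCommGroup P'] [Module k P'] (L : P →ₗ[k] P')
    (t : M ⊗[k] N) (f : M → N → P) : L (ev t f) = ev t (fun a b => L (f a b)) := map_sum _ _ _

theorem ev_mul {T : Type*} [Ring T] (t : M ⊗[k] N) (f : M → N → T) (y : T) :
    ev t f * y = ev t (fun a b => f a b * y) := Finset.sum_mul _ _ _

theorem mul_ev {T : Type*} [Ring T] (t : M ⊗[k] N) (f : M → N → T) (y : T) :
    y * ev t f = ev t (fun a b => y * f a b) := Finset.mul_sum _ _ _

variable (k) in
/-- bilinear functions -/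
structure Bil (f : M → N → P) : Prop where
  add_l : ∀ a a' b, f (a + a') b = f a b + f a' b
  add_r : ∀ a b b', f a (b + b') = f a b + f a b'
  smul_l : ∀ (c : k) a b, f (c • a) b = c • f a b
  smul_r : ∀ (c : k) a b, f a (c • b) = c • f a b

/-- the linear map attached to a bilinear function -/
noncomputable def Bil.toLin {f : M → N → P} (h : Bil k f) : M ⊗[k] N →ₗ[k] P :=
  TensorProduct.lift (LinearMap.mk₂ k f h.add_l h.smul_l h.add_r h.smul_r)

@[simp] theorem Bil.toLin_tmul {f : M → N → P} (h : Bil k f) (a : M) (b : N) :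
    h.toLin (a ⊗ₜ[k] b) = f a b := by simp [Bil.toLin]

theorem Bil.ev {f : M → N → P} (h : Bil k f) (t : M ⊗[k] N) : ev t f = h.toLin t := by
  rw [← ev_lin]; simp

variable (k) in
/-- trilinear functions -/
structure Tri (f : M → N → Q → P) : Prop where
  add_1 : ∀ a a' b c, f (a + a') b c = f a b c + f a' b c
  add_2 : ∀ a b b' c, f a (b + b') c = f a b c + f a b' c
  add_3 : ∀ a b c c', f a b (c + c') = f a b c + f a b c'
  smul_1 : ∀ (z : k) a b c, f (z • a) b c = z • f a b c
  smul_2 : ∀ (z : k) a b c, f a (z • b) c = z • f a b c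
  smul_3 : ∀ (z : k) a b c, f a b (z • c) = z • f a b c

theorem Tri.bil {f : M → N → Q → P} (h : Tri k f) (a : M) : Bil k (f a) :=
  ⟨h.add_2 a, h.add_3 a, fun z => h.smul_2 z a, fun z => h.smul_3 z a⟩

theorem Tri.bil' {f : M → N → Q → P} (h : Tri k f) :
    Bil k (fun a => (fun t => (h.bil a).toLin t : N ⊗[k] Q → P)) := by
  constructor
  · intro a a' t
    rw [← ev_lin, ← ev_lin (h.bil a).toLin, ← ev_lin (h.bil a').toLin]
    simp [PivAux.ev, h.add_1, Finset.sum_add_distrib]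
  · intros; simp
  · intro z a t
    rw [← ev_lin, ← ev_lin (h.bil a).toLin]
    simp [PivAux.ev, h.smul_1, Finset.smul_sum]
  · intros; simp

/-- the linear map attached to a trilinear function -/
noncomputable def Tri.toLin {f : M → N → Q → P} (h : Tri k f) : M ⊗[k] (N ⊗[k] Q) →ₗ[k] P :=
  h.bil'.toLin

@[simp] theorem Tri.toLin_tmul {f : M → N → Q → P} (h : Tri k f) (a : M) (b : N) (c : Q) :
    h.toLin (a ⊗ₜ[k] (b ⊗ₜ[k] c)) = f a b c := by simp [Tri.toLin]

theorem Tri.left {X : Type*} [AddCommGroup X] [Module k X]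
    {f : M → N → Q → P} (h : Tri k f) (D : X →ₗ[k] M ⊗[k] N) (t : X ⊗[k] Q) :
    h.toLin (TensorProduct.assoc k M N Q (TensorProduct.map D LinearMap.id t)) =
      PivAux.ev t (fun p q => PivAux.ev (D p) (fun r s => f r s q)) := by
  have := ev_lin (h.toLin ∘ₗ (TensorProduct.assoc k M N Q).toLinearMap ∘ₗ
    (TensorProduct.map D LinearMap.id)) t
  simp only [LinearMap.comp_apply, LinearEquiv.coe_coe] at this
  rw [← this]
  refine ev_congr _ fun p q => ?_
  have := ev_lin (h.toLin ∘ₗ (TensorProduct.assoc k M N Q).toLinearMap ∘ₗ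
    ((TensorProduct.mk k (M ⊗[k] N) Q).flip q)) (D p)
  simp at this
  simp [← this]

theorem Tri.right {X : Type*} [AddCommGroup X] [Module k X]
    {f : M → N → Q → P} (h : Tri k f) (D : X →ₗ[k] N ⊗[k] Q) (t : M ⊗[k] X) :
    h.toLin (TensorProduct.map LinearMap.id D t) =
      PivAux.ev t (fun p q => PivAux.ev (D q) (fun r s => f p r s)) := by
  have := ev_lin (h.toLin ∘ₗ (TensorProduct.map LinearMap.id D)) t
  simp only [LinearMap.comp_apply, LinearEquiv.coe_coe] at this
  rw [← this]
  refine ev_congr _ fun p q => ?_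
  have := ev_lin (h.toLin ∘ₗ (TensorProduct.mk k M (N ⊗[k] Q) p)) (D q)
  simp at this
  simp [← this]

/-- evaluation of a linear map on a product-like tensor built from two tensors -/
theorem ev_lin2 {M' N' : Type*} [AddCommGroup M'] [Module k M'] [AddCommGroup N'] [Module k N']
    (L : (M ⊗[k] N) ⊗[k] (M' ⊗[k] N') →ₗ[k] P) (t : M ⊗[k] N) (s : M' ⊗[k] N') :
    ev t (fun a b => ev s (fun c d => L ((a ⊗ₜ[k] b) ⊗ₜ[k] (c ⊗ₜ[k] d)))) = L (t ⊗ₜ[k] s) := by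
  have := ev_lin (L ∘ₗ ((TensorProduct.mk k (M ⊗[k] N) (M' ⊗[k] N')).flip s)) t
  simp at this
  rw [← this]
  refine ev_congr _ fun p q => ?_
  have := ev_lin (L ∘ₗ (TensorProduct.mk k (M ⊗[k] N) (M' ⊗[k] N') (p ⊗ₜ q))) s
  simpa using this

end ev
end PivAux

namespace PivAux
open TensorProduct

/-- A quasi-triangular Hopf group-coalgebra with ribbon-like element (total grading). -/
structure TH (k : Type*) {G : Type*} [Field k] [AddCommGroup G] (B : G → Type*)
    [∀ a, Ring (B a)] [∀ a, Algebra k (B a)] where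
  Δ : ∀ {a b c : G}, a + b = c → (B c →ₐ[k] B a ⊗[k] B b)
  ε : B 0 →ₐ[k] k
  S : ∀ {a b : G}, a + b = 0 → (B a →ₗ[k] B b)
  coassoc : ∀ {a b c ab bc abc : G} (h1 : a + b = ab) (h2 : ab + c = abc) (h3 : b + c = bc)
    (h4 : a + bc = abc) (x : B abc),
    TensorProduct.assoc k _ _ _ (TensorProduct.map (Δ h1).toLinearMap LinearMap.id (Δ h2 x)) =
      TensorProduct.map LinearMap.id (Δ h3).toLinearMap (Δ h4 x)
  counit_l : ∀ (a : G) (x : B a), TensorProduct.lid k (B a)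
    (TensorProduct.map ε.toLinearMap LinearMap.id (Δ (zero_add a) x)) = x
  counit_r : ∀ (a : G) (x : B a), TensorProduct.rid k (B a)
    (TensorProduct.map LinearMap.id ε.toLinearMap (Δ (add_zero a) x)) = x
  S_l : ∀ {a b : G} (h : a + b = 0) (z : B 0),
    TensorProduct.lift (LinearMap.mul k (B b)) (TensorProduct.map (S h) LinearMap.id (Δ h z)) =
      ε z • 1
  S_r : ∀ {a b : G} (h : a + b = 0) (h' : b + a = 0) (z : B 0),
    TensorProduct.lift (LinearMap.mul k (B b)) (TensorProduct.map LinearMap.id (S h) (Δ h' z)) =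
      ε z • 1
  S_inj : ∀ {a b : G} (h : a + b = 0) (x y : B a), S h x = S h y → x = y
  R : ∀ a b : G, B a ⊗[k] B b
  R1 : ∀ {a b c : G} (h : a + b = c) (h' : b + a = c) (x : B c),
    R a b * Δ h x = (TensorProduct.comm k _ _ (Δ h' x)) * R a b
  R2 : ∀ {a b c d : G} (h : b + c = d),
    TensorProduct.map LinearMap.id (Δ h).toLinearMap (R a d) =
      (TensorProduct.map (TensorProduct.lift (LinearMap.mul k (B a)))
        (TensorProduct.comm k _ _).toLinearMap)
        (TensorProduct.tensorTensorTensorComm k _ _ _ _ (R a c ⊗ₜ[k] R a b))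
  R3 : ∀ {a b c d : G} (h : a + b = d),
    TensorProduct.map (Δ h).toLinearMap LinearMap.id (R d c) =
      (TensorProduct.map LinearMap.id (TensorProduct.lift (LinearMap.mul k (B c))))
        (TensorProduct.tensorTensorTensorComm k _ _ _ _ (R a c ⊗ₜ[k] R b c))
  v : ∀ a : G, B a
  vinv : ∀ a : G, B a
  v_vinv : ∀ a, v a * vinv a = 1
  vinv_v : ∀ a, vinv a * v a = 1
  u : ∀ a : G, B a
  u_eq : ∀ a, u a = TensorProduct.lift (LinearMap.mul k (B a))
    (TensorProduct.map (S (neg_add_cancel a)) LinearMap.id (TensorProduct.comm k _ _ (R a (-a))))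
  v_sq : ∀ a, v a * v a = u a * S (neg_add_cancel a) (u (-a))
  Δ_v : ∀ {a b c : G} (h : a + b = c), Δ h (v c) =
    (TensorProduct.map
        ((LinearMap.mul k (B a) (v a)) ∘ₗ (TensorProduct.lift (LinearMap.mul k (B a))) ∘ₗ
          (TensorProduct.map (S (neg_add_cancel a)) LinearMap.id))
        ((LinearMap.mul k (B b) (v b)) ∘ₗ (TensorProduct.lift (LinearMap.mul k (B b))) ∘ₗ
          (TensorProduct.map LinearMap.id (S (neg_add_cancel b)))))
        ((TensorProduct.tensorTensorTensorComm k _ _ _ _)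
          (R (-a) b ⊗ₜ[k] (TensorProduct.comm k _ _) (R (-b) a)))

namespace TH
variable {k G : Type*} [Field k] [AddCommGroup G] {B : G → Type*}
    [∀ a, Ring (B a)] [∀ a, Algebra k (B a)] (T : TH k B)
variable {P : Type*} [AddCommGroup P] [Module k P]

theorem co {a b c ab bc abc : G} (h1 : a + b = ab) (h2 : ab + c = abc) (h3 : b + c = bc)
    (h4 : a + bc = abc) (x : B abc) {F : B a → B b → B c → P} (hF : Tri k F) :
    ev (T.Δ h2 x) (fun p q => ev (T.Δ h1 p) (fun r s => F r s q)) =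
      ev (T.Δ h4 x) (fun p q => ev (T.Δ h3 q) (fun r s => F p r s)) := by
  have := congrArg hF.toLin (T.coassoc h1 h2 h3 h4 x)
  rw [hF.left, hF.right] at this
  exact this

theorem eps_l {a : G} (x : B a) {f : B a → P} (ha : ∀ x y, f (x + y) = f x + f y)
    (hs : ∀ (c : k) x, f (c • x) = c • f x) :
    ev (T.Δ (zero_add a) x) (fun p q => T.ε p • f q) = f x := by
  let L : B a →ₗ[k] P := ⟨⟨f, ha⟩, hs⟩
  have := congrArg L (T.counit_l a x)
  have h2 := ev_lin (L ∘ₗ (TensorProduct.lid k (B a)).toLinearMap ∘ₗ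
    (TensorProduct.map T.ε.toLinearMap LinearMap.id)) (T.Δ (zero_add a) x)
  refine Eq.trans ?_ (h2.trans this)
  refine ev_congr _ fun p q => ?_
  simp [L, hs]

theorem eps_r {a : G} (x : B a) {f : B a → P} (ha : ∀ x y, f (x + y) = f x + f y)
    (hs : ∀ (c : k) x, f (c • x) = c • f x) :
    ev (T.Δ (add_zero a) x) (fun p q => T.ε q • f p) = f x := by
  let L : B a →ₗ[k] P := ⟨⟨f, ha⟩, hs⟩
  have := congrArg L (T.counit_r a x)
  have h2 := ev_lin (L ∘ₗ (TensorProduct.rid k (B a)).toLinearMap ∘ₗ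
    (TensorProduct.map LinearMap.id T.ε.toLinearMap)) (T.Δ (add_zero a) x)
  refine Eq.trans ?_ (h2.trans this)
  refine ev_congr _ fun p q => ?_
  simp [L, hs]

theorem Sl {a b : G} (h : a + b = 0) (z : B 0) :
    ev (T.Δ h z) (fun p q => T.S h p * q) = T.ε z • 1 := by
  rw [← T.S_l h z, ← LinearMap.comp_apply, ← ev_lin]
  simp

theorem Sr {a b : G} (h : a + b = 0) (h' : b + a = 0) (z : B 0) :
    ev (T.Δ h' z) (fun p q => p * T.S h q) = T.ε z • 1 := by
  rw [← T.S_r h h' z, ← LinearMap.comp_apply, ← ev_lin]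
  simp

theorem r1 {a b c : G} (h : a + b = c) (h' : b + a = c) (x : B c) {f : B a → B b → P}
    (hf : Bil k f) :
    ev (T.R a b) (fun m n => ev (T.Δ h x) (fun p q => f (m * p) (n * q))) =
      ev (T.Δ h' x) (fun p q => ev (T.R a b) (fun m n => f (q * m) (p * n))) := by
  have := congrArg hf.toLin (T.R1 h h' x)
  have e1 := ev_lin2 (hf.toLin ∘ₗ LinearMap.mul' k (B a ⊗[k] B b)) (T.R a b) (T.Δ h x)
  have e2 := ev_lin2 (hf.toLin ∘ₗ LinearMap.mul' k (B a ⊗[k] B b) ∘ₗ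
    (TensorProduct.map (TensorProduct.comm k _ _).toLinearMap LinearMap.id)) (T.Δ h' x) (T.R a b)
  simp at e1 e2
  rw [e1, e2, this]

theorem r2 {a b c d : G} (h : b + c = d) {F : B a → B b → B c → P} (hF : Tri k F) :
    ev (T.R a d) (fun p q => ev (T.Δ h q) (fun r s => F p r s)) =
      ev (T.R a c) (fun p q => ev (T.R a b) (fun r s => F (p * r) s q)) := by
  have := congrArg hF.toLin (T.R2 (a := a) h)
  rw [hF.right] at this
  refine this.trans ?_
  have e1 := ev_lin2 (hF.toLin ∘ₗ ((TensorProduct.map (TensorProduct.lift (LinearMap.mul k (B a)))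
        (TensorProduct.comm k _ _).toLinearMap)) ∘ₗ
        (TensorProduct.tensorTensorTensorComm k _ _ _ _).toLinearMap) (T.R a c) (T.R a b)
  simp at e1
  exact e1.symm

theorem r3 {a b c d : G} (h : a + b = d) {F : B a → B b → B c → P} (hF : Tri k F) :
    ev (T.R d c) (fun p q => ev (T.Δ h p) (fun r s => F r s q)) =
      ev (T.R a c) (fun p q => ev (T.R b c) (fun r s => F p r (q * s))) := by
  have := congrArg (fun t => hF.toLin (TensorProduct.assoc k _ _ _ t)) (T.R3 (c := c) h)
  rw [hF.left] at this
  refine this.trans ?_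
  have e1 := ev_lin2 (hF.toLin ∘ₗ (TensorProduct.assoc k _ _ _).toLinearMap ∘ₗ
     (TensorProduct.map LinearMap.id (TensorProduct.lift (LinearMap.mul k (B c)))) ∘ₗ
        (TensorProduct.tensorTensorTensorComm k _ _ _ _).toLinearMap) (T.R a c) (T.R b c)
  simp at e1
  exact e1.symm

theorem u_ev (a : G) : T.u a = ev (T.R a (-a)) (fun p q => T.S (neg_add_cancel a) q * p) := by
  rw [T.u_eq, ← LinearEquiv.coe_toLinearMap, ← LinearMap.comp_apply, ← LinearMap.comp_apply,
    ← ev_lin]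
  simp

end TH
end PivAux

namespace PivAux
open TensorProduct
namespace TH
variable {k G : Type*} [Field k] [AddCommGroup G] {B : G → Type*}
    [∀ a, Ring (B a)] [∀ a, Algebra k (B a)] (T : TH k B)
variable {P : Type*} [AddCommGroup P] [Module k P]

theorem ev_mulmul {a b : G} (s t : B a ⊗[k] B b) {f : B a → B b → P} (hf : Bil k f) :
    ev (s * t) f = ev s (fun p q => ev t (fun r w => f (p * r) (q * w))) := by
  have e1 := ev_lin2 (hf.toLin ∘ₗ LinearMap.mul' k (B a ⊗[k] B b)) s t
  simp at e1
  rw [e1, hf.ev]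

theorem smul_ev {M N : Type*} [AddCommGroup M] [Module k M] [AddCommGroup N] [Module k N]
    (t : M ⊗[k] N) (f : M → N → P) (c : k) :
    c • ev t f = ev t (fun a b => c • f a b) := Finset.smul_sum

theorem S_one {a b : G} (h : a + b = 0) : T.S h 1 = 1 := by
  have := T.S_l h 1
  simpa [Algebra.TensorProduct.one_def] using this

/-- conclusion of the convolution argument: right antipode cancellation -/
theorem S_mul {a b : G} (h : a + b = 0) (x y : B a) :
    T.S h (x * y) = T.S h y * T.S h x := by
  have h' : b + a = 0 := by rw [add_comm]; exact h
  have A : ev (T.Δ (add_zero a) x) (fun x1 z => ev (T.Δ h' z) (fun x2 x3 =>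
      ev (T.Δ (add_zero a) y) (fun y1 w => ev (T.Δ h' w) (fun y2 y3 =>
        T.S h (x1 * y1) * (x2 * y2) * (T.S h y3 * T.S h x3))))) = T.S h (x * y) := by
    have e1 : ∀ x1 x2 x3, ev (T.Δ (add_zero a) y) (fun y1 w => ev (T.Δ h' w) (fun y2 y3 =>
        T.S h (x1 * y1) * (x2 * y2) * (T.S h y3 * T.S h x3))) =
        T.S h (x1 * y) * (x2 * T.S h x3) := by
      intro x1 x2 x3
      rw [← T.eps_r y (f := fun y => T.S h (x1 * y) * (x2 * T.S h x3))
        (by intros; simp [mul_add, add_mul]) (by intros; simp)]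
      refine ev_congr _ fun y1 w => ?_
      have := congrArg (fun t => T.S h (x1 * y1) * x2 * t * T.S h x3) (T.Sr h h' w)
      simp only [mul_ev, ev_mul] at this
      simpa [mul_assoc] using this
    simp only [e1]
    rw [← T.eps_r x (f := fun x => T.S h (x * y))
        (by intros; simp [add_mul]) (by intros; simp)]
    refine ev_congr _ fun x1 w => ?_
    have := congrArg (fun t => T.S h (x1 * y) * t) (T.Sr h h' w)
    simp only [mul_ev] at this
    simpa using this
  rw [← A]
  rw [← T.co h (zero_add a) h' (add_zero a) x (F := fun x1 x2 x3 =>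
      ev (T.Δ (add_zero a) y) (fun y1 w => ev (T.Δ h' w) (fun y2 y3 =>
        T.S h (x1 * y1) * (x2 * y2) * (T.S h y3 * T.S h x3))))
      (by constructor <;> intros <;>
        simp [ev, mul_add, add_mul, Finset.sum_add_distrib, Finset.smul_sum])]
  have e2 : ∀ x1 x2 x3, ev (T.Δ (add_zero a) y) (fun y1 w => ev (T.Δ h' w) (fun y2 y3 =>
        T.S h (x1 * y1) * (x2 * y2) * (T.S h y3 * T.S h x3))) =
      ev (T.Δ (zero_add a) y) (fun w y3 => ev (T.Δ h w) (fun y1 y2 =>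
        T.S h (x1 * y1) * (x2 * y2) * (T.S h y3 * T.S h x3))) := by
    intro x1 x2 x3
    exact (T.co h (zero_add a) h' (add_zero a) y (F := fun y1 y2 y3 =>
        T.S h (x1 * y1) * (x2 * y2) * (T.S h y3 * T.S h x3))
      (by constructor <;> intros <;> simp [mul_add, add_mul])).symm
  simp only [e2]
  rw [← T.eps_l x (f := fun x => T.S h y * T.S h x)
        (by intros; simp [mul_add]) (by intros; simp)]
  refine ev_congr _ fun z x3 => ?_
  rw [ev_swap]
  rw [← T.eps_l y (f := fun y => T.S h y * T.S h x3)
        (by intros; simp [add_mul]) (by intros; simp)]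
  rw [smul_ev]
  refine ev_congr _ fun w y3 => ?_
  have := T.Sl h (z * w)
  rw [map_mul, ev_mulmul (k := k) _ _ (f := fun p q => T.S h p * q)
    (by constructor <;> intros <;> simp [mul_add, add_mul])] at this
  have := congrArg (fun t => t * (T.S h y3 * T.S h x3)) this
  simp only [ev_mul] at this
  simpa [mul_smul] using this

/-- uniqueness of convolution inverses -/
theorem conv_unique {A : Type*} [Ring A] [Algebra k A] {e f : G} (h : e + f = 0) (h' : f + e = 0)
    (φ σ : B e →ₗ[k] A) (ψ : B f →ₗ[k] A)
    (h1 : ∀ z, ev (T.Δ h z) (fun p q => φ p * ψ q) = T.ε z • (1 : A))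
    (h2 : ∀ z, ev (T.Δ h' z) (fun p q => ψ p * σ q) = T.ε z • (1 : A)) (x : B e) :
    φ x = σ x := by
  have hF : Tri k (fun p q r => φ p * ψ q * σ r) := by
    constructor <;> intros <;> simp [mul_add, add_mul]
  have := T.co h (zero_add e) h' (add_zero e) x hF
  rw [← T.eps_l x (f := fun x => σ x) (by intros; simp) (by intros; simp)]
  rw [← T.eps_r x (f := fun x => φ x) (by intros; simp) (by intros; simp)]
  refine Eq.trans ?_ (this.symm.trans ?_)
  · refine ev_congr _ fun p q => ?_
    simp only [mul_assoc, ← mul_ev, h2]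
    simp
  · refine ev_congr _ fun p q => ?_
    simp only [← ev_mul, h1]
    simp

theorem S_Δ {a b c a' b' c' : G} (hc : c' + c = 0) (ha : a' + a = 0) (hb : b' + b = 0)
    (h : a + b = c) (h' : b' + a' = c') (x : B c') :
    T.Δ h (T.S hc x) = ev (T.Δ h' x) (fun p q => T.S ha q ⊗ₜ[k] T.S hb p) := by
  have hc' : c + c' = 0 := by rw [add_comm]; exact hc
  have ha' : a + a' = 0 := by rw [add_comm]; exact ha
  have hb' : b + b' = 0 := by rw [add_comm]; exact hb
  have hσ : Bil k (fun (p : B b') (q : B a') => T.S ha q ⊗ₜ[k] T.S hb p) := by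
    constructor <;> intros <;> simp [tmul_add, add_tmul, smul_tmul']
  rw [hσ.ev]
  refine T.conv_unique hc hc' ((T.Δ h).toLinearMap ∘ₗ T.S hc) (hσ.toLin ∘ₗ (T.Δ h').toLinearMap)
    (T.Δ h).toLinearMap ?_ ?_ x
  · intro z
    have := congrArg (T.Δ h).toLinearMap (T.Sl hc z)
    rw [map_ev] at this
    simpa using this
  · intro z
    have hG : ∀ r s, Bil k (fun (t : B b') (w : B a') =>
        (r ⊗ₜ[k] s : B a ⊗[k] B b) * (T.S ha w ⊗ₜ[k] T.S hb t)) := by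
      intro r s; constructor <;> intros <;> simp [mul_add, tmul_add, add_tmul, smul_tmul']
    have e1 : ∀ p q, (T.Δ h).toLinearMap p * (hσ.toLin ∘ₗ (T.Δ h').toLinearMap) q =
        ev (T.Δ h p) (fun r s => (hG r s).toLin (T.Δ h' q)) := by
      intro p q
      simp only [← Bil.ev, LinearMap.comp_apply]
      simp only [← mul_ev, ← ev_mul]
      congr 1
      exact (ev_tmul _).symm
    simp only [e1]
    have hbc : b + c' = a' := by rw [← h', ← add_assoc, hb', zero_add]
    rw [T.co h hc' hbc ha' z (F := fun r s q => (hG r s).toLin (T.Δ h' q)) ?_]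
    · have e2 : ∀ p q, ev (T.Δ hbc q) (fun r s => (hG p r).toLin (T.Δ h' s)) =
          (p * T.S ha q) ⊗ₜ[k] (1 : B b) := by
        intro p q
        simp only [← Bil.ev]
        rw [← T.co hb' (zero_add a') h' hbc q (F := fun r t w =>
          (p ⊗ₜ[k] r : B a ⊗[k] B b) * (T.S ha w ⊗ₜ[k] T.S hb t))
          (by constructor <;> intros <;> simp [mul_add, tmul_add, add_tmul, add_mul, smul_tmul'])]
        rw [← T.eps_l q (f := fun q => (p * T.S ha q) ⊗ₜ[k] (1 : B b))
          (by intros; simp [mul_add, add_tmul]) (by intros; simp [smul_tmul'])]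
        refine ev_congr _ fun y w => ?_
        have := congrArg (fun t => (p * T.S ha w) ⊗ₜ[k] t) (T.Sr hb hb' y)
        simp only [ev, tmul_sum] at this
        simpa [ev] using this
      simp only [e2]
      have := congrArg (fun t => t ⊗ₜ[k] (1 : B b)) (T.Sr ha ha' z)
      simp only [ev, sum_tmul] at this
      simpa [ev, smul_tmul', Algebra.TensorProduct.one_def] using this
    · constructor
      · intros; simp only [← Bil.ev]
        simp [ev, add_tmul, add_mul, Finset.sum_add_distrib]
      · intros; simp only [← Bil.ev]
        simp [ev, tmul_add, add_tmul, add_mul, Finset.sum_add_distrib]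
      · intros; simp
      · intros; simp only [← Bil.ev]
        simp [ev, smul_tmul', Finset.smul_sum]
      · intros; simp only [← Bil.ev]
        simp [ev, smul_tmul', Finset.smul_sum]
      · intros; simp

end TH
end PivAux

namespace PivAux
open TensorProduct
namespace TH
variable {k G : Type*} [Field k] [AddCommGroup G] {B : G → Type*}
    [∀ a, Ring (B a)] [∀ a, Algebra k (B a)] (T : TH k B)
variable {P : Type*} [AddCommGroup P] [Module k P]

theorem ybe {a b c : G} {F : B a → B b → B c → P} (hF : Tri k F) :
    ev (T.R a b) (fun x y => ev (T.R a c) (fun p q => ev (T.R b c) (fun r s =>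
      F (x * p) (y * r) (q * s)))) =
    ev (T.R a b) (fun x y => ev (T.R b c) (fun p q => ev (T.R a c) (fun r s =>
      F (r * x) (p * y) (q * s)))) := by
  have e1 : ∀ x y, ev (T.R a c) (fun p q => ev (T.R b c) (fun r s =>
      F (x * p) (y * r) (q * s))) =
      ev (T.R (a + b) c) (fun p q => ev (T.Δ (rfl : a + b = a + b) p) (fun r s =>
        F (x * r) (y * s) q)) := by
    intro x y
    exact (T.r3 (rfl : a + b = a + b) (F := fun r s q => F (x * r) (y * s) q)
      (by constructor <;> intros <;> simp [mul_add, hF.add_1, hF.add_2, hF.add_3,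
        hF.smul_1, hF.smul_2, hF.smul_3])).symm
  have e2 : ∀ x y, ev (T.R b c) (fun p q => ev (T.R a c) (fun r s =>
      F (r * x) (p * y) (q * s))) =
      ev (T.R (a + b) c) (fun p q => ev (T.Δ (add_comm b a) p) (fun r s =>
        F (s * x) (r * y) q)) := by
    intro x y
    exact (T.r3 (add_comm b a) (F := fun r s q => F (s * x) (r * y) q)
      (by constructor <;> intros <;> simp [add_mul, hF.add_1, hF.add_2, hF.add_3,
        hF.smul_1, hF.smul_2, hF.smul_3])).symm
  simp only [e1, e2]
  rw [ev_swap, ev_swap (T.R a b)]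
  refine ev_congr _ fun p q => ?_
  rw [T.r1 rfl (add_comm b a) p (f := fun m n => F m n q), ev_swap]
  exact ⟨fun _ _ _ => hF.add_1 _ _ _ _, fun _ _ _ => hF.add_2 _ _ _ _,
    fun _ _ _ => hF.smul_1 _ _ _ _, fun _ _ _ => hF.smul_2 _ _ _ _⟩

/-- `u x = S²(x) u` -/
theorem u_mul {a : G} (x : B a) :
    T.u a * x = T.S (neg_add_cancel a) (T.S (add_neg_cancel a) x) * T.u a := by
  set s := T.S (neg_add_cancel a) with hs
  set s' := T.S (add_neg_cancel a) with hs'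
  have hE : Tri k (fun (x1 : B a) (x2 : B (-a)) (x3 : B a) => ev (T.R a (-a)) (fun p q =>
      s (s' x3) * (s (q * x2) * (p * x1)))) := by
    constructor <;> intros <;>
      simp [ev, mul_add, add_mul, Finset.sum_add_distrib, Finset.smul_sum]
  have A : ev (T.Δ (add_zero a) x) (fun x1 z => ev (T.Δ (neg_add_cancel a) z) (fun x2 x3 =>
      ev (T.R a (-a)) (fun p q => s (s' x3) * (s (q * x2) * (p * x1))))) = T.u a * x := by
    rw [← T.eps_r x (f := fun x => T.u a * x) (by intros; simp [mul_add]) (by intros; simp)]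
    refine ev_congr _ fun x1 z => ?_
    rw [ev_swap, u_ev, ev_mul, smul_ev]
    refine ev_congr _ fun p q => ?_
    have := congrArg (fun t => s (q * t) * (p * x1)) (T.Sr (add_neg_cancel a) (neg_add_cancel a) z)
    simp only [mul_ev, map_ev, ev_mul] at this
    simp only [hs, T.S_mul] at this ⊢
    simpa [mul_assoc, ← hs', T.S_one] using this
  have C := T.co (add_neg_cancel a) (zero_add a) (neg_add_cancel a) (add_zero a) x hE
  rw [← A, ← C, ← T.eps_l x (f := fun x => s (s' x) * T.u a) (by intros; simp [add_mul])
    (by intros; simp)]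
  refine ev_congr _ fun z x3 => ?_
  rw [ev_swap, T.r1 (add_neg_cancel a) (neg_add_cancel a) z (f := fun m n =>
      s (s' x3) * (s n * m)) (by constructor <;> intros <;> simp [mul_add, add_mul]), ev_swap,
    u_ev, mul_ev, smul_ev]
  refine ev_congr _ fun p q => ?_
  have := congrArg (fun t => s (s' x3) * (s q * (t * p))) (T.Sl (neg_add_cancel a) z)
  simp only [mul_ev, ev_mul] at this
  simp only [hs, T.S_mul] at this ⊢
  simpa [mul_assoc] using this

/-- `(ε ⊗ id) R` -/
noncomputable def e (b : G) : B b := ev (T.R 0 b) (fun p q => T.ε p • q)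
/-- `(id ⊗ ε) R` -/
noncomputable def e' (a : G) : B a := ev (T.R a 0) (fun p q => T.ε q • p)

theorem e_mul {a b : G} {f : B a → B b → P} (hf : Bil k f) :
    ev (T.R a b) (fun p q => f p (q * T.e b)) = ev (T.R a b) f := by
  have := T.r3 (c := b) (add_zero a) (F := fun r s q => T.ε s • f r q)
    (by constructor <;> intros <;> simp [hf.add_l, hf.add_r, hf.smul_l, hf.smul_r, smul_smul,
      add_smul, mul_comm])
  have e1 : ∀ p q, ev (T.Δ (add_zero a) p) (fun r s => T.ε s • f r q) = f p q := fun p q =>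
    T.eps_r p (f := fun p => f p q) (fun _ _ => hf.add_l _ _ _) (fun _ _ => hf.smul_l _ _ _)
  simp only [e1] at this
  refine Eq.trans ?_ this.symm
  refine ev_congr _ fun p q => ?_
  let L : B b →ₗ[k] P := ⟨⟨fun y => f p (q * y), by intros; simp [mul_add, hf.add_r]⟩,
    by intros; simp [hf.smul_r]⟩
  change L (T.e b) = _
  rw [e, map_ev]
  simp [L]

theorem e'_mul {a b : G} {f : B a → B b → P} (hf : Bil k f) :
    ev (T.R a b) (fun p q => f (p * T.e' a) q) = ev (T.R a b) f := by
  have := T.r2 (a := a) (zero_add b) (F := fun p r s => T.ε r • f p s)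
    (by constructor <;> intros <;> simp [hf.add_l, hf.add_r, hf.smul_l, hf.smul_r, smul_smul,
      add_smul, mul_comm])
  have e1 : ∀ p q, ev (T.Δ (zero_add b) q) (fun r s => T.ε r • f p s) = f p q := fun p q =>
    T.eps_l q (f := fun q => f p q) (fun _ _ => hf.add_r _ _ _) (fun _ _ => hf.smul_r _ _ _)
  simp only [e1] at this
  refine Eq.trans ?_ this.symm
  refine ev_congr _ fun p q => ?_
  let L : B a →ₗ[k] P := ⟨⟨fun y => f (p * y) q, by intros; simp [mul_add, hf.add_l]⟩,
    by intros; simp [hf.smul_l]⟩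
  change L (T.e' a) = _
  rw [e', map_ev]
  simp [L]

theorem u_rinv (a : G) :
    T.u a * (T.S (neg_add_cancel a) (T.u (-a)) * (T.vinv a * T.vinv a)) = 1 := by
  rw [← mul_assoc, ← T.v_sq, mul_assoc, ← mul_assoc (T.v a) (T.vinv a), T.v_vinv, one_mul,
    T.v_vinv]

theorem u_cancel {a : G} {x : B a} (h : x * T.u a = T.u a) : x = 1 := by
  have := congrArg (fun t => t * (T.S (neg_add_cancel a) (T.u (-a)) * (T.vinv a * T.vinv a))) h
  simp only [mul_assoc] at this
  rwa [T.u_rinv, mul_one] at this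

theorem e'_one (a : G) : T.e' a = 1 := by
  have h1 : T.u a * T.e' a = T.u a := by
    conv_rhs => rw [u_ev]
    rw [← T.e'_mul (by constructor <;> intros <;> simp [mul_add, add_mul]), u_ev, ev_mul]
    simp only [mul_assoc]
  rw [u_mul] at h1
  have := T.u_cancel h1
  rw [← T.S_one (neg_add_cancel a)] at this
  have := T.S_inj _ _ _ this
  rw [← T.S_one (add_neg_cancel a)] at this
  exact T.S_inj _ _ _ this

theorem e_one' (a : G) : T.e (-a) = 1 := by
  have h1 : T.S (neg_add_cancel a) (T.e (-a)) * T.u a = T.u a := by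
    conv_rhs => rw [u_ev]
    rw [← T.e_mul (by constructor <;> intros <;> simp [mul_add, add_mul]), u_ev, mul_ev]
    simp only [T.S_mul, mul_assoc]
  have := T.u_cancel h1
  rw [← T.S_one (neg_add_cancel a)] at this
  exact T.S_inj _ _ _ this

theorem e_one (a : G) : T.e a = 1 := by
  have := T.e_one' (-a)
  rwa [neg_neg] at this

theorem R_linv {a a' b : G} (h : a' + a = 0) {f : B a → B b → P} (hf : Bil k f) :
    ev (T.R a' b) (fun p q => ev (T.R a b) (fun r s => f (T.S h p * r) (q * s))) = f 1 1 := by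
  rw [← T.r3 h (F := fun r s q => f (T.S h r * s) q)
    (by constructor <;> intros <;> simp [hf.add_l, hf.add_r, hf.smul_l, hf.smul_r, mul_add,
      add_mul])]
  rw [← T.e_one b]
  let L1 : ∀ q, B a →ₗ[k] P := fun q => ⟨⟨fun y => f y q, by intros; simp [hf.add_l]⟩,
    by intros; simp [hf.smul_l]⟩
  let L : B b →ₗ[k] P := ⟨⟨fun y => f 1 y, by intros; simp [hf.add_r]⟩,
    by intros; simp [hf.smul_r]⟩
  change _ = L (T.e b)
  rw [e, map_ev]
  refine ev_congr _ fun p q => ?_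
  have := congrArg (L1 q) (T.Sl h p)
  rw [map_ev] at this
  refine this.trans ?_
  simp [L1, L]

theorem T2 {a b b' : G} (h : b' + b = 0) {f : B a → B b → P} (hf : Bil k f) :
    ev (T.R a b) (fun p q => ev (T.R a b') (fun r s => f (p * r) (T.S h s * q))) = f 1 1 := by
  rw [← T.r2 h (F := fun p r s => f p (T.S h r * s))
    (by constructor <;> intros <;> simp [hf.add_l, hf.add_r, hf.smul_l, hf.smul_r, mul_add,
      add_mul])]
  rw [← T.e'_one a]
  let L1 : ∀ q, B b →ₗ[k] P := fun q => ⟨⟨fun y => f q y, by intros; simp [hf.add_r]⟩,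
    by intros; simp [hf.smul_r]⟩
  let L : B a →ₗ[k] P := ⟨⟨fun y => f y 1, by intros; simp [hf.add_l]⟩,
    by intros; simp [hf.smul_l]⟩
  change _ = L (T.e' a)
  rw [e', map_ev]
  refine ev_congr _ fun p q => ?_
  have := congrArg (L1 p) (T.Sl h q)
  rw [map_ev] at this
  refine this.trans ?_
  simp [L1, L]

end TH
end PivAux

namespace PivAux
open TensorProduct
namespace TH
variable {k G : Type*} [Field k] [AddCommGroup G] {B : G → Type*}
    [∀ a, Ring (B a)] [∀ a, Algebra k (B a)] (T : TH k B)

theorem comm_mul' {a b : G} (s t : B a ⊗[k] B b) :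
    TensorProduct.comm k _ _ (s * t) = TensorProduct.comm k _ _ s * TensorProduct.comm k _ _ t :=
  map_mul (Algebra.TensorProduct.comm k (B a) (B b)) s t

/-- `R₂₁` -/
noncomputable def Q (a b : G) : B a ⊗[k] B b := TensorProduct.comm k _ _ (T.R b a)

theorem QR_comm {a b c : G} (h : a + b = c) (x : B c) :
    T.Δ h x * (T.Q a b * T.R a b) = T.Q a b * (T.R a b * T.Δ h x) := by
  have h' : b + a = c := by rw [add_comm]; exact h
  have := congrArg (TensorProduct.comm k _ _) (T.R1 h' h x)
  rw [comm_mul', comm_mul'] at this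
  rw [T.R1 h h', ← mul_assoc, ← mul_assoc]
  congr 1
  rw [Q, this]
  congr 1
  exact ((TensorProduct.comm k _ _).symm_apply_apply _).symm

theorem tmul_ev {M N X Y : Type*} [AddCommGroup M] [Module k M] [AddCommGroup N] [Module k N]
    [AddCommGroup X] [Module k X] [AddCommGroup Y] [Module k Y]
    (t : M ⊗[k] N) (f : M → N → Y) (x : X) :
    x ⊗ₜ[k] ev t f = ev t (fun a b => x ⊗ₜ[k] f a b) := by simp [ev, tmul_sum]

theorem ev_tmul' {M N X Y : Type*} [AddCommGroup M] [Module k M] [AddCommGroup N] [Module k N]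
    [AddCommGroup X] [Module k X] [AddCommGroup Y] [Module k Y]
    (t : M ⊗[k] N) (f : M → N → Y) (x : X) :
    ev t f ⊗ₜ[k] x = ev t (fun a b => f a b ⊗ₜ[k] x) := by simp [ev, sum_tmul]

set_option maxHeartbeats 1000000 in
theorem Δ_u {a b c : G} (h : a + b = c) :
    T.Δ h (T.u c) * (T.Q a b * T.R a b) = T.u a ⊗ₜ[k] T.u b := by
  have h' : -b + -a = -c := by rw [← h]; abel
  set Sa := T.S (neg_add_cancel a) with hSa
  set Sb := T.S (neg_add_cancel b) with hSb
  have s1 : T.Δ h (T.u c) * (T.Q a b * T.R a b) =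
      ev (T.R c (-c)) (fun p q => ev (T.Δ h' q) (fun t w =>
        (Sa w ⊗ₜ[k] Sb t) * (T.Q a b * (T.R a b * T.Δ h p)))) := by
    rw [u_ev, ← AlgHom.toLinearMap_apply, map_ev, ev_mul]
    refine ev_congr _ fun p q => ?_
    rw [AlgHom.toLinearMap_apply, map_mul, mul_assoc, QR_comm,
      T.S_Δ (neg_add_cancel c) (neg_add_cancel a) (neg_add_cancel b) h h', ev_mul]
  rw [s1]
  rw [T.r2 h' (F := fun p t w => (Sa w ⊗ₜ[k] Sb t) * (T.Q a b * (T.R a b * T.Δ h p)))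
    (by constructor <;> intros <;> simp only [map_add, map_smul, mul_add, add_mul, tmul_add,
        add_tmul, ← smul_tmul', tmul_smul, smul_mul_assoc, mul_smul_comm])]
  have s3 : ∀ p r, T.R a b * T.Δ h (p * r) = ev (T.Δ h p) (fun p1 p2 => ev (T.Δ h r) (fun r1 r2 =>
      ev (T.R a b) (fun x y => ((x * p1) * r1) ⊗ₜ[k] ((y * p2) * r2)))) := by
    intro p r
    rw [map_mul, ← mul_assoc]
    conv_lhs => rw [← ev_tmul (T.R a b * T.Δ h p * T.Δ h r)]
    rw [ev_mulmul _ _ (by constructor <;> intros <;> simp [tmul_add, add_tmul, smul_tmul']),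
      ev_mulmul _ _ (by constructor <;> intros <;>
        simp [ev, add_mul, tmul_add, add_tmul, smul_tmul', Finset.sum_add_distrib,
          Finset.smul_sum])]
    rw [ev_swap]
    refine ev_congr _ fun p1 p2 => ?_
    rw [ev_swap]
  simp only [s3, mul_ev]
  have s4 : ∀ p q, ev (T.R c (-b)) (fun r s => ev (T.Δ h p) (fun p1 p2 => ev (T.Δ h r)
      (fun r1 r2 => ev (T.R a b) (fun x y => (Sa q ⊗ₜ[k] Sb s) *
        (T.Q a b * (((x * p1) * r1) ⊗ₜ[k] ((y * p2) * r2))))))) =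
      ev (T.Δ h p) (fun p1 p2 => ev (T.R a (-b)) (fun b1 b2 => ev (T.R b (-b)) (fun d1 d2 =>
        ev (T.R a b) (fun x y => (Sa q ⊗ₜ[k] Sb (b2 * d2)) *
        (T.Q a b * (((x * p1) * b1) ⊗ₜ[k] ((y * p2) * d1))))))) := by
    intro p q
    rw [ev_swap]
    refine ev_congr _ fun p1 p2 => ?_
    exact T.r3 h (F := fun r1 r2 s => ev (T.R a b) (fun x y => (Sa q ⊗ₜ[k] Sb s) *
        (T.Q a b * (((x * p1) * r1) ⊗ₜ[k] ((y * p2) * r2)))))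
      (by constructor <;> intros <;> simp only [map_add, map_smul, mul_add, add_mul, tmul_add,
        add_tmul, ← smul_tmul', tmul_smul, smul_mul_assoc, mul_smul_comm, ev,
        Finset.sum_add_distrib, Finset.smul_sum])
  simp only [s4]
  rw [T.r3 h (F := fun p1 p2 q => ev (T.R a (-b)) (fun b1 b2 => ev (T.R b (-b)) (fun d1 d2 =>
        ev (T.R a b) (fun x y => (Sa q ⊗ₜ[k] Sb (b2 * d2)) *
        (T.Q a b * (((x * p1) * b1) ⊗ₜ[k] ((y * p2) * d1)))))))
      (by constructor <;> intros <;> simp only [map_add, map_smul, mul_add, add_mul, tmul_add,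
        add_tmul, ← smul_tmul', tmul_smul, smul_mul_assoc, mul_smul_comm, ev,
        Finset.sum_add_distrib, Finset.smul_sum])]
  simp only [ev_swap (T.R b (-a)) (T.R a (-b)), ev_swap (T.R b (-a)) (T.R b (-b)),
    ev_swap (T.R b (-a)) (T.R a b), ev_swap (T.R a (-a)) (T.R a (-b)),
    ev_swap (T.R a (-a)) (T.R b (-b)), ev_swap (T.R a (-a)) (T.R a b)]
  have s5 : ∀ b1 b2 d1 d2, ev (T.R a b) (fun x y => ev (T.R a (-a)) (fun a1 a2 =>
      ev (T.R b (-a)) (fun c1 c2 => (Sa (a2 * c2) ⊗ₜ[k] Sb (b2 * d2)) *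
        (T.Q a b * (((x * a1) * b1) ⊗ₜ[k] ((y * c1) * d1)))))) =
      ev (T.R a b) (fun x y => ev (T.R b (-a)) (fun c1 c2 =>
      ev (T.R a (-a)) (fun a1 a2 => (Sa (c2 * a2) ⊗ₜ[k] Sb (b2 * d2)) *
        (T.Q a b * ((a1 * (x * b1)) ⊗ₜ[k] (c1 * (y * d1))))))) := by
    intro b1 b2 d1 d2
    refine (T.ybe (F := fun l m n => (Sa n ⊗ₜ[k] Sb (b2 * d2)) *
        (T.Q a b * ((l * b1) ⊗ₜ[k] (m * d1))))
      (by constructor <;> intros <;> simp only [map_add, map_smul, mul_add, add_mul, tmul_add,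
        add_tmul, ← smul_tmul', tmul_smul, smul_mul_assoc, mul_smul_comm])).trans ?_
    simp only [mul_assoc]
  simp only [s5]
  simp only [ev_swap (T.R a (-b)) (T.R a b), ev_swap (T.R b (-b)) (T.R a b),
    ev_swap (T.R a b) (T.R b (-a)), ev_swap (T.R a b) (T.R a (-a)),
    ev_swap (T.R a (-b)) (T.R b (-a)), ev_swap (T.R a (-b)) (T.R a (-a)),
    ev_swap (T.R b (-b)) (T.R b (-a)), ev_swap (T.R b (-b)) (T.R a (-a))]
  have hQ : ∀ z, T.Q a b * z = ev (T.R b a) (fun e1 e2 => (e2 ⊗ₜ[k] e1) * z) := by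
    intro z
    rw [← ev_mul]
    congr 1
    rw [Q, ← LinearEquiv.coe_toLinearMap, ← ev_lin]
    simp
  have s6 : ∀ c1 c2 a1 a2, ev (T.R a b) (fun x y => ev (T.R a (-b)) (fun b1 b2 =>
      ev (T.R b (-b)) (fun d1 d2 => (Sa (c2 * a2) ⊗ₜ[k] Sb (b2 * d2)) *
        (T.Q a b * ((a1 * (x * b1)) ⊗ₜ[k] (c1 * (y * d1))))))) =
      ev (T.R a b) (fun x y => ev (T.R b (-b)) (fun d1 d2 => ev (T.R a (-b)) (fun b1 b2 =>
      ev (T.R b a) (fun e1 e2 => (Sa a2 * ((Sa c2 * e2) * (a1 * (b1 * x)))) ⊗ₜ[k]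
        (Sb b2 * (Sb d2 * ((e1 * c1) * (d1 * y)))))))) := by
    intro c1 c2 a1 a2
    refine (T.ybe (F := fun l m n => (Sa (c2 * a2) ⊗ₜ[k] Sb n) *
        (T.Q a b * ((a1 * l) ⊗ₜ[k] (c1 * m))))
      (by constructor <;> intros <;> simp only [map_add, map_smul, mul_add, add_mul, tmul_add,
        add_tmul, ← smul_tmul', tmul_smul, smul_mul_assoc, mul_smul_comm])).trans ?_
    simp only [hSa, hSb, T.S_mul, hQ, mul_ev, Algebra.TensorProduct.tmul_mul_tmul, mul_assoc]
  simp only [s6]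
  simp only [ev_swap (T.R b (-a)) (T.R a (-a)), ev_swap (T.R b (-a)) (T.R a b),
    ev_swap (T.R b (-a)) (T.R b (-b)), ev_swap (T.R b (-a)) (T.R a (-b)),
    ev_swap (T.R b (-a)) (T.R b a)]
  have s7 : ∀ a1 a2 x y d1 d2 b1 b2, ev (T.R b a) (fun e1 e2 => ev (T.R b (-a)) (fun c1 c2 =>
      (Sa a2 * ((Sa c2 * e2) * (a1 * (b1 * x)))) ⊗ₜ[k]
        (Sb b2 * (Sb d2 * ((e1 * c1) * (d1 * y)))))) =
      ((Sa a2 * a1) * (b1 * x)) ⊗ₜ[k] (Sb b2 * ((Sb d2 * d1) * y)) := by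
    intro a1 a2 x y d1 d2 b1 b2
    refine (T.T2 (neg_add_cancel a) (f := fun m n => (Sa a2 * (n * (a1 * (b1 * x)))) ⊗ₜ[k]
        (Sb b2 * (Sb d2 * (m * (d1 * y)))))
      (by constructor <;> intros <;> simp only [map_add, map_smul, mul_add, add_mul, tmul_add,
        add_tmul, ← smul_tmul', tmul_smul, smul_mul_assoc, mul_smul_comm])).trans ?_
    simp only [one_mul, mul_assoc]
  simp only [s7]
  simp only [ev_swap (T.R b (-b)) (T.R a (-b)), ev_swap (T.R a b) (T.R a (-b)),
    ev_swap (T.R a (-a)) (T.R a (-b)), ev_swap (T.R a (-a)) (T.R a b)]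
  simp only [← tmul_ev, ← ev_tmul', ← mul_ev, ← ev_mul]
  simp only [hSa, hSb, ← T.u_ev, T.u_mul]
  refine Eq.trans ?_ ((T.T2 (a := a) (add_neg_cancel b) (f := fun m n => (T.u a * m) ⊗ₜ[k]
    (T.S (neg_add_cancel b) n * T.u b)) (by constructor <;> intros <;> simp only [map_add,
        map_smul, mul_add, add_mul, tmul_add,
        add_tmul, ← smul_tmul', tmul_smul, smul_mul_assoc, mul_smul_comm])).trans ?_)
  · simp only [T.S_mul, mul_assoc, T.u_mul]
  · simp [T.S_one]

theorem Δ_vQR {a b c : G} (h : a + b = c) :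
    T.Δ h (T.v c) * (T.Q a b * T.R a b) = T.v a ⊗ₜ[k] T.v b := by
  set Sa := T.S (neg_add_cancel a) with hSa
  set Sb := T.S (neg_add_cancel b) with hSb
  have e1 : ev (T.R (-a) b) (fun p q => Sa p ⊗ₜ[k] q) * T.R a b = 1 := by
    have := T.R_linv (b := b) (neg_add_cancel a) (f := fun x y => x ⊗ₜ[k] y)
      (by constructor <;> intros <;> simp [tmul_add, add_tmul, smul_tmul'])
    rw [Algebra.TensorProduct.one_def, ← this, ev_mul]
    refine ev_congr _ fun p q => ?_
    conv_lhs => rw [← ev_tmul (T.R a b)]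
    rw [mul_ev]
    simp [hSa]
  have e2 : ev (T.R (-b) a) (fun p q => q ⊗ₜ[k] Sb p) * T.Q a b = 1 := by
    have := T.R_linv (b := a) (neg_add_cancel b) (f := fun x y => y ⊗ₜ[k] x)
      (by constructor <;> intros <;> simp [tmul_add, add_tmul, smul_tmul'])
    rw [Algebra.TensorProduct.one_def, ← this, ev_mul]
    refine ev_congr _ fun p q => ?_
    rw [Q, ← ev_tmul (T.R b a), ← LinearEquiv.coe_toLinearMap, map_ev, mul_ev, ev_tmul]
    simp [hSb]
  have e3 : T.Δ h (T.v c) = (T.v a ⊗ₜ[k] T.v b) * (ev (T.R (-a) b) (fun p q => Sa p ⊗ₜ[k] q) *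
      ev (T.R (-b) a) (fun p q => q ⊗ₜ[k] Sb p)) := by
    rw [T.Δ_v]
    have := ev_lin2 (((TensorProduct.map
        ((LinearMap.mul k (B a) (T.v a)) ∘ₗ (TensorProduct.lift (LinearMap.mul k (B a))) ∘ₗ
          (TensorProduct.map (T.S (neg_add_cancel a)) LinearMap.id))
        ((LinearMap.mul k (B b) (T.v b)) ∘ₗ (TensorProduct.lift (LinearMap.mul k (B b))) ∘ₗ
          (TensorProduct.map LinearMap.id (T.S (neg_add_cancel b)))))) ∘ₗ
        (TensorProduct.tensorTensorTensorComm k _ _ _ _).toLinearMap ∘ₗ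
        (TensorProduct.map LinearMap.id (TensorProduct.comm k _ _).toLinearMap))
        (T.R (-a) b) (T.R (-b) a)
    simp only [LinearMap.comp_apply, TensorProduct.map_tmul, LinearMap.id_apply,
      LinearEquiv.coe_coe] at this
    rw [← this, ev_mul, mul_ev]
    refine ev_congr _ fun p q => ?_
    rw [mul_ev, mul_ev]
    refine ev_congr _ fun r s => ?_
    simp [hSa, hSb]
  rw [e3, mul_assoc, mul_assoc, ← mul_assoc _ (T.Q a b), e2, one_mul, e1, mul_one]

/-- the pivotal element -/
theorem grouplike {a b c : G} (h : a + b = c) :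
    T.Δ h (T.u c * T.vinv c) = (T.u a * T.vinv a) ⊗ₜ[k] (T.u b * T.vinv b) := by
  have h1 : T.Δ h (T.u c * T.vinv c) * (T.v a ⊗ₜ[k] T.v b) = T.u a ⊗ₜ[k] T.u b := by
    rw [← T.Δ_vQR h, ← mul_assoc, ← map_mul, mul_assoc, T.vinv_v, mul_one, T.Δ_u]
  have := congrArg (fun t => t * (T.vinv a ⊗ₜ[k] T.vinv b)) h1
  simp only [mul_assoc, Algebra.TensorProduct.tmul_mul_tmul, T.v_vinv] at this
  rwa [← Algebra.TensorProduct.one_def, mul_one] at this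

theorem counit_g : T.ε (T.u 0 * T.vinv 0) = 1 := by
  set g := T.u 0 * T.vinv 0 with hg
  have h1 := T.counit_l 0 g
  rw [hg, T.grouplike, ← hg] at h1
  simp only [TensorProduct.map_tmul, TensorProduct.lid_tmul, LinearMap.id_apply,
    AlgHom.toLinearMap_apply] at h1
  have h2 := congrArg (fun t => T.ε (t * (T.v 0 *
    (T.S (neg_add_cancel 0) (T.u (-0)) * (T.vinv 0 * T.vinv 0))))) h1
  have h3 : g * (T.v 0 * (T.S (neg_add_cancel 0) (T.u (-0)) * (T.vinv 0 * T.vinv 0))) = 1 := by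
    rw [hg, mul_assoc, ← mul_assoc (T.vinv 0) (T.v 0), T.vinv_v, one_mul, T.u_rinv]
  simp only [smul_mul_assoc, h3] at h2
  simpa using h2

end TH
end PivAux

namespace PivAux
open TensorProduct

section F
variable {k G : Type*} [Field k] [AddCommGroup G] (C : HopfGBialgebra k G)

/-- totalized product -/
noncomputable def mulF : (G →₀ C.A) →ₗ[k] (G →₀ C.A) →ₗ[k] (G →₀ C.A) :=
  Finsupp.lsum k (fun a => LinearMap.flip (Finsupp.lsum k (fun b =>
    LinearMap.flip (LinearMap.compr₂ C.mul (Finsupp.lsingle (a + b))))))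

@[simp] theorem mulF_single (a b : G) (x y : C.A) :
    mulF C (Finsupp.single a x) (Finsupp.single b y) = Finsupp.single (a + b) (C.mul x y) := by
  simp [mulF]

/-- totalized coproduct -/
noncomputable def comulF (a b : G) : (G →₀ C.A) →ₗ[k] (G →₀ C.A) ⊗[k] (G →₀ C.A) :=
  Finsupp.lsum k (fun γ => TensorProduct.map (Finsupp.lsingle γ) (Finsupp.lsingle γ) ∘ₗ C.comul a b)

@[simp] theorem comulF_single (a b γ : G) (x : C.A) :
    comulF C a b (Finsupp.single γ x) =
      TensorProduct.map (Finsupp.lsingle γ) (Finsupp.lsingle γ) (C.comul a b x) := by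
  simp [comulF]

/-- totalized antipode -/
noncomputable def SF (a : G) : (G →₀ C.A) →ₗ[k] (G →₀ C.A) :=
  Finsupp.lsum k (fun γ => Finsupp.lsingle (-γ) ∘ₗ C.S a γ)

@[simp] theorem SF_single (a γ : G) (x : C.A) :
    SF C a (Finsupp.single γ x) = Finsupp.single (-γ) (C.S a γ x) := by
  simp [SF]

/-- totalized counit -/
noncomputable def epsF : (G →₀ C.A) →ₗ[k] k := Finsupp.lsum k (fun γ => C.counit γ)

@[simp] theorem epsF_single (γ : G) (x : C.A) : epsF C (Finsupp.single γ x) = C.counit γ x := by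
  simp [epsF]

/-- totalized components -/
noncomputable def Bs (a : G) : Submodule k (G →₀ C.A) :=
  ⨆ γ, (C.H a γ).map (Finsupp.lsingle γ)

theorem single_mem {a γ : G} {x : C.A} (hx : x ∈ C.H a γ) : Finsupp.single γ x ∈ Bs C a :=
  Submodule.mem_iSup_of_mem γ ⟨x, hx, rfl⟩

theorem Bs_ind {a : G} {p : (G →₀ C.A) → Prop}
    (h1 : ∀ γ, ∀ x ∈ C.H a γ, p (Finsupp.single γ x)) (h0 : p 0)
    (hadd : ∀ x y, p x → p y → p (x + y)) {x : G →₀ C.A} (hx : x ∈ Bs C a) : p x := by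
  refine Submodule.iSup_induction _ (motive := p) hx ?_ h0 hadd
  rintro γ _ ⟨x, hx, rfl⟩
  exact h1 γ x hx

theorem Bs_lin {P : Type*} [AddCommGroup P] [Module k P] {a : G} (f g : (G →₀ C.A) →ₗ[k] P)
    (h : ∀ γ, ∀ x ∈ C.H a γ, f (Finsupp.single γ x) = g (Finsupp.single γ x))
    {x : G →₀ C.A} (hx : x ∈ Bs C a) : f x = g x :=
  Bs_ind C (p := fun x => f x = g x) h (by simp) (fun x y hx hy => by simp [hx, hy]) hx

theorem mulF_mem {a : G} {x y : G →₀ C.A} (hx : x ∈ Bs C a) (hy : y ∈ Bs C a) :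
    mulF C x y ∈ Bs C a := by
  refine Bs_ind C (p := fun x => mulF C x y ∈ Bs C a) ?_ (by simp) ?_ hx
  · intro γ x hx
    refine Bs_ind C (p := fun y => mulF C (Finsupp.single γ x) y ∈ Bs C a) ?_ (by simp) ?_ hy
    · intro δ y hy
      rw [mulF_single]
      exact single_mem C (C.mul_mem hx hy)
    · intro x y hx hy; rw [map_add]; exact add_mem hx hy
  · intro x y hx hy; rw [map_add]; exact add_mem hx hy

theorem mulF_assoc {a : G} {x y z : G →₀ C.A} (hx : x ∈ Bs C a) (hy : y ∈ Bs C a)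
    (hz : z ∈ Bs C a) : mulF C (mulF C x y) z = mulF C x (mulF C y z) := by
  refine Bs_ind C (p := fun x => mulF C (mulF C x y) z = mulF C x (mulF C y z)) ?_ (by simp) ?_ hx
  · intro γ x hx
    refine Bs_ind C (p := fun y => mulF C (mulF C (Finsupp.single γ x) y) z =
      mulF C (Finsupp.single γ x) (mulF C y z)) ?_ (by simp) ?_ hy
    · intro δ y hy
      refine Bs_ind C (p := fun z => mulF C (mulF C (Finsupp.single γ x) (Finsupp.single δ y)) z =
        mulF C (Finsupp.single γ x) (mulF C (Finsupp.single δ y) z)) ?_ (by simp) ?_ hz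
      · intro ζ z hz
        simp [C.mul_assoc' hx hy hz, add_assoc]
      · intro x y hx hy; simp only [map_add, hx, hy]
    · intro x y hx hy; simp [hx, hy]
  · intro x y hx hy; simp [hx, hy]

/-- the totalized algebras -/
def BT (a : G) : Type _ := ↥(Bs C a)

noncomputable instance (a : G) : AddCommGroup (BT C a) := inferInstanceAs (AddCommGroup (Bs C a))
noncomputable instance (a : G) : Module k (BT C a) := inferInstanceAs (Module k (Bs C a))

/-- inclusion -/
noncomputable def ι (a : G) : BT C a →ₗ[k] (G →₀ C.A) := (Bs C a).subtype

theorem ι_inj (a : G) : Function.Injective (ι C a) := Subtype.val_injective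

theorem ι_mem {a : G} (x : BT C a) : ι C a x ∈ Bs C a := x.2

theorem range_ι (a : G) {x : G →₀ C.A} (hx : x ∈ Bs C a) : ∃ y, ι C a y = x := ⟨⟨x, hx⟩, rfl⟩

noncomputable instance (a : G) : Mul (BT C a) :=
  ⟨fun x y => ⟨mulF C (ι C a x) (ι C a y), mulF_mem C x.2 y.2⟩⟩

noncomputable instance (a : G) : One (BT C a) :=
  ⟨⟨Finsupp.single 0 (C.one a), single_mem C (C.one_mem a)⟩⟩

@[simp] theorem ι_mul {a : G} (x y : BT C a) : ι C a (x * y) = mulF C (ι C a x) (ι C a y) := rfl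
@[simp] theorem ι_one {a : G} : ι C a 1 = Finsupp.single 0 (C.one a) := rfl

noncomputable instance (a : G) : Ring (BT C a) :=
  { (inferInstance : AddCommGroup (BT C a)), (inferInstance : Mul (BT C a)),
    (inferInstance : One (BT C a)) with
    left_distrib := fun x y z => ι_inj C a (by simp)
    right_distrib := fun x y z => ι_inj C a (by simp)
    zero_mul := fun x => ι_inj C a (by simp)
    mul_zero := fun x => ι_inj C a (by simp)
    mul_assoc := fun x y z => ι_inj C a (by simp [mulF_assoc C (ι_mem C x) (ι_mem C y) (ι_mem C z)])
    one_mul := fun x => ι_inj C a (by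
      rw [ι_mul, ι_one]
      refine Bs_lin C (mulF C (Finsupp.single 0 (C.one a))) LinearMap.id ?_ (ι_mem C x)
      intro γ x hx
      simp [C.one_mul' hx])
    mul_one := fun x => ι_inj C a (by
      rw [ι_mul, ι_one]
      refine Bs_lin C ((mulF C).flip (Finsupp.single 0 (C.one a))) LinearMap.id ?_ (ι_mem C x)
      intro γ x hx
      simp [C.mul_one' hx]) }

noncomputable instance (a : G) : Algebra k (BT C a) :=
  Algebra.ofModule (fun r x y => ι_inj C a (by simp)) (fun r x y => ι_inj C a (by simp))

/-- inclusion of tensor squares -/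
noncomputable def ι2 (a b : G) : BT C a ⊗[k] BT C b →ₗ[k] (G →₀ C.A) ⊗[k] (G →₀ C.A) :=
  TensorProduct.map (ι C a) (ι C b)

theorem map_inj' {M N M' N' : Type*} [AddCommGroup M] [Module k M] [AddCommGroup N] [Module k N]
    [AddCommGroup M'] [Module k M'] [AddCommGroup N'] [Module k N'] (f : M →ₗ[k] M')
    (g : N →ₗ[k] N') (hf : Function.Injective f) (hg : Function.Injective g) :
    Function.Injective (TensorProduct.map f g) := by
  exact TensorProduct.map_injective_of_flat_flat f g hf hg

theorem ι2_inj (a b : G) : Function.Injective (ι2 C a b) :=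
  map_inj' _ _ (ι_inj C a) (ι_inj C b)

@[simp] theorem ι2_tmul (a b : G) (x : BT C a) (y : BT C b) :
    ι2 C a b (x ⊗ₜ[k] y) = ι C a x ⊗ₜ[k] ι C b y := rfl

/-- inclusion of tensor cubes -/
noncomputable def ι3 (a b c : G) : BT C a ⊗[k] (BT C b ⊗[k] BT C c) →ₗ[k]
    (G →₀ C.A) ⊗[k] ((G →₀ C.A) ⊗[k] (G →₀ C.A)) :=
  TensorProduct.map (ι C a) (ι2 C b c)

theorem ι3_inj (a b c : G) : Function.Injective (ι3 C a b c) :=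
  map_inj' _ _ (ι_inj C a) (ι2_inj C b c)

theorem range_aux {a b γ δ : G} {t : C.A ⊗[k] C.A}
    (ht : t ∈ LinearMap.range (TensorProduct.map (C.H a γ).subtype (C.H b δ).subtype)) :
    TensorProduct.map (Finsupp.lsingle γ) (Finsupp.lsingle δ) t ∈ LinearMap.range (ι2 C a b) := by
  obtain ⟨s, rfl⟩ := ht
  induction s using TensorProduct.induction_on with
  | zero => simp
  | tmul x y =>
    obtain ⟨x', hx⟩ := range_ι C a (single_mem C x.2)
    obtain ⟨y', hy⟩ := range_ι C b (single_mem C y.2)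
    exact ⟨x' ⊗ₜ y', by simp [hx, hy]⟩
  | add x y hx hy => rw [map_add, map_add]; exact add_mem hx hy

theorem comulF_mem {a b c : G} (h : a + b = c) (x : BT C c) :
    comulF C a b (ι C c x) ∈ LinearMap.range (ι2 C a b) := by
  subst h
  refine Bs_ind C (p := fun x => comulF C a b x ∈ LinearMap.range (ι2 C a b)) ?_ (by simp) ?_
    (ι_mem C x)
  · intro γ x hx
    rw [comulF_single]
    exact range_aux C (C.comul_mem hx)
  · intro x y hx hy; rw [map_add]; exact add_mem hx hy

/-- coproduct on totalized algebras -/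
noncomputable def Dl {a b c : G} (h : a + b = c) : BT C c →ₗ[k] BT C a ⊗[k] BT C b :=
  (LinearEquiv.ofInjective (ι2 C a b) (ι2_inj C a b)).symm.toLinearMap ∘ₗ
    LinearMap.codRestrict _ (comulF C a b ∘ₗ ι C c) (comulF_mem C h)

@[simp] theorem ι2_Dl {a b c : G} (h : a + b = c) (x : BT C c) :
    ι2 C a b (Dl C h x) = comulF C a b (ι C c x) := by
  have := (LinearEquiv.ofInjective (ι2 C a b) (ι2_inj C a b)).apply_symm_apply
    (LinearMap.codRestrict _ (comulF C a b ∘ₗ ι C c) (comulF_mem C h) x)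
  exact congrArg Subtype.val this

theorem tmulMul_tmul {M N : Type*} [AddCommGroup M] [Module k M]
    [AddCommGroup N] [Module k N]
    (p : M →ₗ[k] M →ₗ[k] M) (q : N →ₗ[k] N →ₗ[k] N) (x x' : M) (y y' : N) :
    tmulMul p q (x ⊗ₜ y) (x' ⊗ₜ y') = p x x' ⊗ₜ q y y' := by simp [tmulMul]

theorem ι2_mul {a b : G} (s t : BT C a ⊗[k] BT C b) :
    ι2 C a b (s * t) = tmulMul (mulF C) (mulF C) (ι2 C a b s) (ι2 C a b t) := by
  induction s using TensorProduct.induction_on with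
  | zero => simp
  | add x y hx hy => simp [add_mul, hx, hy]
  | tmul x y =>
    induction t using TensorProduct.induction_on with
    | zero => simp
    | add x y hx hy => simp [mul_add, hx, hy]
    | tmul x' y' => simp [tmulMul_tmul]

theorem tm_single (γ γ' δ δ' : G) (s t : C.A ⊗[k] C.A) :
    TensorProduct.map (Finsupp.lsingle (γ + γ')) (Finsupp.lsingle (δ + δ'))
      (tmulMul C.mul C.mul s t) =
    tmulMul (mulF C) (mulF C) (TensorProduct.map (Finsupp.lsingle γ) (Finsupp.lsingle δ) s)
      (TensorProduct.map (Finsupp.lsingle γ') (Finsupp.lsingle δ') t) := by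
  induction s using TensorProduct.induction_on with
  | zero => simp
  | add x y hx hy => simp [hx, hy]
  | tmul x y =>
    induction t using TensorProduct.induction_on with
    | zero => simp
    | add x y hx hy => simp only [map_add, hx, hy]
    | tmul x' y' => simp [tmulMul_tmul]

theorem comulF_mul {a b : G} {x y : G →₀ C.A} (hx : x ∈ Bs C (a + b)) (hy : y ∈ Bs C (a + b)) :
    comulF C a b (mulF C x y) = tmulMul (mulF C) (mulF C) (comulF C a b x) (comulF C a b y) := by
  refine Bs_ind C (p := fun x => comulF C a b (mulF C x y) =
    tmulMul (mulF C) (mulF C) (comulF C a b x) (comulF C a b y)) ?_ (by simp) ?_ hx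
  · intro γ x hx
    refine Bs_ind C (p := fun y => comulF C a b (mulF C (Finsupp.single γ x) y) =
      tmulMul (mulF C) (mulF C) (comulF C a b (Finsupp.single γ x)) (comulF C a b y)) ?_ (by simp)
      ?_ hy
    · intro δ y hy
      rw [mulF_single, comulF_single, comulF_single, comulF_single, C.comul_mul a b γ δ x y hx hy,
        ← tm_single]
      rfl
    · intro x y hx hy; simp [hx, hy]
  · intro x y hx hy; simp [hx, hy]

/-- coproduct as an algebra map -/
noncomputable def DA {a b c : G} (h : a + b = c) : BT C c →ₐ[k] BT C a ⊗[k] BT C b :=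
  AlgHom.ofLinearMap (Dl C h)
    (ι2_inj C a b (by
      subst h
      simp [Algebra.TensorProduct.one_def, C.comul_one]))
    (fun x y => ι2_inj C a b (by
      subst h
      rw [ι2_Dl, ι2_mul, ι_mul, comulF_mul C (ι_mem C x) (ι_mem C y), ι2_Dl, ι2_Dl]))

@[simp] theorem ι2_DA {a b c : G} (h : a + b = c) (x : BT C c) :
    ι2 C a b (DA C h x) = comulF C a b (ι C c x) := ι2_Dl C h x

theorem epsF_mul {x y : G →₀ C.A} (hx : x ∈ Bs C 0) (hy : y ∈ Bs C 0) :
    epsF C (mulF C x y) = epsF C x * epsF C y := by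
  refine Bs_ind C (p := fun x => epsF C (mulF C x y) = epsF C x * epsF C y) ?_ (by simp) ?_ hx
  · intro γ x hx
    refine Bs_ind C (p := fun y => epsF C (mulF C (Finsupp.single γ x) y) =
      epsF C (Finsupp.single γ x) * epsF C y) ?_ (by simp) ?_ hy
    · intro δ y hy
      simp [C.counit_mul γ δ x y hx hy]
    · intro x y hx hy; simp [hx, hy, mul_add]
  · intro x y hx hy; simp [hx, hy, add_mul]

/-- counit as an algebra map -/
noncomputable def EA : BT C 0 →ₐ[k] k :=
  AlgHom.ofLinearMap (epsF C ∘ₗ ι C 0) (by simp [C.counit_one])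
    (fun x y => by simp [epsF_mul C (ι_mem C x) (ι_mem C y)])

@[simp] theorem EA_apply (x : BT C 0) : EA C x = epsF C (ι C 0 x) := rfl

theorem SF_mem {a b : G} (h : a + b = 0) (x : BT C a) : SF C a (ι C a x) ∈ Bs C b := by
  obtain rfl := eq_neg_of_add_eq_zero_right h
  refine Bs_ind C (p := fun x => SF C a x ∈ Bs C (-a)) ?_ (by simp) ?_ (ι_mem C x)
  · intro γ x hx
    rw [SF_single]
    exact single_mem C (C.S_mem hx)
  · intro x y hx hy; rw [map_add]; exact add_mem hx hy

/-- antipode on totalized algebras -/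
noncomputable def SA {a b : G} (h : a + b = 0) : BT C a →ₗ[k] BT C b :=
  LinearMap.codRestrict (Bs C b) (SF C a ∘ₗ ι C a) (SF_mem C h)

@[simp] theorem ι_SA {a b : G} (h : a + b = 0) (x : BT C a) :
    ι C b (SA C h x) = SF C a (ι C a x) := rfl

end F
end PivAux

namespace PivAux
open TensorProduct

section gen
variable {k : Type*} [Field k]
variable {M N P Q M' N' P' Q' : Type*} [AddCommGroup M] [Module k M] [AddCommGroup N] [Module k N]
  [AddCommGroup P] [Module k P] [AddCommGroup Q] [Module k Q]
  [AddCommGroup M'] [Module k M'] [AddCommGroup N'] [Module k N']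
  [AddCommGroup P'] [Module k P'] [AddCommGroup Q'] [Module k Q']

theorem ext2 (L L' : M ⊗[k] N →ₗ[k] P) (h : ∀ x y, L (x ⊗ₜ y) = L' (x ⊗ₜ y)) (t : M ⊗[k] N) :
    L t = L' t := LinearMap.congr_fun (TensorProduct.ext' h) t

/-- a bilinear map in two tensors is determined on pure tensors -/
theorem ext4 (L L' : (M ⊗[k] N) ⊗[k] (P ⊗[k] Q) →ₗ[k] M')
    (h : ∀ x y z w, L ((x ⊗ₜ y) ⊗ₜ (z ⊗ₜ w)) = L' ((x ⊗ₜ y) ⊗ₜ (z ⊗ₜ w)))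
    (t : (M ⊗[k] N) ⊗[k] (P ⊗[k] Q)) : L t = L' t := by
  refine ext2 L L' (fun s s' => ?_) t
  refine ext2 (L ∘ₗ (TensorProduct.mk k _ _).flip s') (L' ∘ₗ (TensorProduct.mk k _ _).flip s')
    (fun x y => ?_) s
  exact ext2 (L ∘ₗ (TensorProduct.mk k _ _) (x ⊗ₜ y)) (L' ∘ₗ (TensorProduct.mk k _ _) (x ⊗ₜ y))
    (fun z w => h x y z w) s'

theorem assoc_nat (f : M →ₗ[k] M') (g : N →ₗ[k] N') (h : P →ₗ[k] P') (t : (M ⊗[k] N) ⊗[k] P) :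
    TensorProduct.assoc k _ _ _ (TensorProduct.map (TensorProduct.map f g) h t) =
      TensorProduct.map f (TensorProduct.map g h) (TensorProduct.assoc k _ _ _ t) := by
  refine ext2 ((TensorProduct.assoc k _ _ _).toLinearMap ∘ₗ
    TensorProduct.map (TensorProduct.map f g) h)
    (TensorProduct.map f (TensorProduct.map g h) ∘ₗ (TensorProduct.assoc k _ _ _).toLinearMap)
    (fun s y => ?_) t
  induction s using TensorProduct.induction_on with
  | zero => simp
  | tmul a b => simp
  | add a b ha hb => simp only [TensorProduct.add_tmul, map_add, ha, hb]

theorem ttt_nat (f : M →ₗ[k] M') (g : N →ₗ[k] N') (h : P →ₗ[k] P') (e : Q →ₗ[k] Q')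
    (t : (M ⊗[k] N) ⊗[k] (P ⊗[k] Q)) :
    TensorProduct.tensorTensorTensorComm k _ _ _ _
      (TensorProduct.map (TensorProduct.map f g) (TensorProduct.map h e) t) =
      TensorProduct.map (TensorProduct.map f h) (TensorProduct.map g e)
        (TensorProduct.tensorTensorTensorComm k _ _ _ _ t) := by
  exact ext4 ((TensorProduct.tensorTensorTensorComm k _ _ _ _).toLinearMap ∘ₗ
    TensorProduct.map (TensorProduct.map f g) (TensorProduct.map h e))
    (TensorProduct.map (TensorProduct.map f h) (TensorProduct.map g e) ∘ₗ
      (TensorProduct.tensorTensorTensorComm k _ _ _ _).toLinearMap) (by simp) t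

theorem comm_nat (f : M →ₗ[k] M') (g : N →ₗ[k] N') (t : M ⊗[k] N) :
    TensorProduct.comm k _ _ (TensorProduct.map f g t) =
      TensorProduct.map g f (TensorProduct.comm k _ _ t) :=
  ext2 ((TensorProduct.comm k _ _).toLinearMap ∘ₗ TensorProduct.map f g)
    (TensorProduct.map g f ∘ₗ (TensorProduct.comm k _ _).toLinearMap) (by simp) t

theorem map_sq {M₁ N₁ M₂ N₂ : Type*} [AddCommGroup M₁] [Module k M₁] [AddCommGroup N₁] [Module k N₁]
    [AddCommGroup M₂] [Module k M₂] [AddCommGroup N₂] [Module k N₂]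
    {f : M →ₗ[k] M'} {g : N →ₗ[k] N'} {p : M' →ₗ[k] M₁} {q : N' →ₗ[k] N₁}
    {p' : M →ₗ[k] M₂} {q' : N →ₗ[k] N₂} {f' : M₂ →ₗ[k] M₁} {g' : N₂ →ₗ[k] N₁}
    (h : ∀ x, p (f x) = f' (p' x)) (h' : ∀ x, q (g x) = g' (q' x)) (t : M ⊗[k] N) :
    TensorProduct.map p q (TensorProduct.map f g t) =
      TensorProduct.map f' g' (TensorProduct.map p' q' t) :=
  ext2 (TensorProduct.map p q ∘ₗ TensorProduct.map f g)
    (TensorProduct.map f' g' ∘ₗ TensorProduct.map p' q') (by simp [h, h']) t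

theorem lift_nat {μ : M →ₗ[k] N →ₗ[k] P} {μ' : M' →ₗ[k] N' →ₗ[k] P'} {f : M →ₗ[k] M'}
    {g : N →ₗ[k] N'} {e : P →ₗ[k] P'} (h : ∀ x y, e (μ x y) = μ' (f x) (g y)) (t : M ⊗[k] N) :
    TensorProduct.lift μ' (TensorProduct.map f g t) = e (TensorProduct.lift μ t) :=
  ext2 (TensorProduct.lift μ' ∘ₗ TensorProduct.map f g) (e ∘ₗ TensorProduct.lift μ)
    (by simp [h]) t

end gen

section H
variable {k G : Type*} [Field k] [AddCommGroup G] (C : HopfGBialgebra k G)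

theorem comulF_coassoc (a b c : G) {z : G →₀ C.A} (hz : z ∈ Bs C (a + b + c)) :
    TensorProduct.assoc k _ _ _ (TensorProduct.map (comulF C a b) LinearMap.id
      (comulF C (a + b) c z)) =
    TensorProduct.map LinearMap.id (comulF C b c) (comulF C a (b + c) z) := by
  refine Bs_lin C ((TensorProduct.assoc k _ _ _).toLinearMap ∘ₗ
    TensorProduct.map (comulF C a b) LinearMap.id ∘ₗ (comulF C (a + b) c))
    (TensorProduct.map LinearMap.id (comulF C b c) ∘ₗ comulF C a (b + c)) ?_ hz
  intro γ x hx
  simp only [LinearMap.comp_apply, comulF_single, LinearEquiv.coe_coe]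
  rw [map_sq (f' := TensorProduct.map (Finsupp.lsingle γ) (Finsupp.lsingle γ))
    (g' := Finsupp.lsingle γ) (p' := C.comul a b) (q' := LinearMap.id)
    (by simp) (by simp), assoc_nat, C.coassoc a b c γ x hx]
  exact (map_sq (by simp) (by simp) _).symm

theorem DA_coassoc {a b c ab bc abc : G} (h1 : a + b = ab) (h2 : ab + c = abc) (h3 : b + c = bc)
    (h4 : a + bc = abc) (x : BT C abc) :
    TensorProduct.assoc k _ _ _ (TensorProduct.map (DA C h1).toLinearMap LinearMap.id (DA C h2 x)) =
      TensorProduct.map LinearMap.id (DA C h3).toLinearMap (DA C h4 x) := by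
  subst h1 h3 h2
  apply ι3_inj
  have key := comulF_coassoc C a b c (ι_mem C x)
  rw [← ι2_DA C rfl, ← ι2_DA C h4] at key
  refine Eq.trans ?_ (key.trans ?_)
  · refine (assoc_nat _ _ _ _).symm.trans ?_
    congr 1
    exact map_sq (by intro x; exact ι2_DA C rfl x) (by simp) _
  · exact map_sq (by simp) (by intro x; exact (ι2_DA C rfl x).symm) _

theorem DA_counit_l (a : G) (x : BT C a) : TensorProduct.lid k (BT C a)
    (TensorProduct.map (EA C).toLinearMap LinearMap.id (DA C (zero_add a) x)) = x := by
  apply ι_inj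
  have h1 : ∀ t : BT C 0 ⊗[k] BT C a, ι C a (TensorProduct.lid k (BT C a)
      (TensorProduct.map (EA C).toLinearMap LinearMap.id t)) = TensorProduct.lid k _
      (TensorProduct.map (epsF C) LinearMap.id (ι2 C 0 a t)) := fun t =>
    ext2 (ι C a ∘ₗ (TensorProduct.lid k (BT C a)).toLinearMap ∘ₗ
      (TensorProduct.map (EA C).toLinearMap LinearMap.id))
      ((TensorProduct.lid k _).toLinearMap ∘ₗ
      (TensorProduct.map (epsF C) LinearMap.id) ∘ₗ (ι2 C 0 a)) (by intro x y; simp) t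
  rw [h1, ι2_DA]
  refine Bs_lin C ((TensorProduct.lid k _).toLinearMap ∘ₗ
      (TensorProduct.map (epsF C) LinearMap.id) ∘ₗ comulF C 0 a) LinearMap.id ?_ (ι_mem C x)
  intro γ x hx
  have h2 := congrArg (Finsupp.lsingle (R := k) γ) (C.counit_comul a γ x hx)
  refine Eq.trans ?_ h2
  simp only [LinearMap.comp_apply, comulF_single, LinearEquiv.coe_coe]
  exact ext2 ((TensorProduct.lid k _).toLinearMap ∘ₗ
      (TensorProduct.map (epsF C) LinearMap.id) ∘ₗ
      TensorProduct.map (Finsupp.lsingle γ) (Finsupp.lsingle γ))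
      (Finsupp.lsingle γ ∘ₗ (TensorProduct.lid k _).toLinearMap ∘ₗ
      (TensorProduct.map (C.counit γ) LinearMap.id)) (by intro x y; simp) _

theorem DA_counit_r (a : G) (x : BT C a) : TensorProduct.rid k (BT C a)
    (TensorProduct.map LinearMap.id (EA C).toLinearMap (DA C (add_zero a) x)) = x := by
  apply ι_inj
  have h1 : ∀ t : BT C a ⊗[k] BT C 0, ι C a (TensorProduct.rid k (BT C a)
      (TensorProduct.map LinearMap.id (EA C).toLinearMap t)) = TensorProduct.rid k _
      (TensorProduct.map LinearMap.id (epsF C) (ι2 C a 0 t)) := fun t =>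
    ext2 (ι C a ∘ₗ (TensorProduct.rid k (BT C a)).toLinearMap ∘ₗ
      (TensorProduct.map LinearMap.id (EA C).toLinearMap))
      ((TensorProduct.rid k _).toLinearMap ∘ₗ
      (TensorProduct.map LinearMap.id (epsF C)) ∘ₗ (ι2 C a 0)) (by intro x y; simp) t
  rw [h1, ι2_DA]
  refine Bs_lin C ((TensorProduct.rid k _).toLinearMap ∘ₗ
      (TensorProduct.map LinearMap.id (epsF C)) ∘ₗ comulF C a 0) LinearMap.id ?_ (ι_mem C x)
  intro γ x hx
  have h2 := congrArg (Finsupp.lsingle (R := k) γ) (C.comul_counit a γ x hx)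
  refine Eq.trans ?_ h2
  simp only [LinearMap.comp_apply, comulF_single, LinearEquiv.coe_coe]
  exact ext2 ((TensorProduct.rid k _).toLinearMap ∘ₗ
      (TensorProduct.map LinearMap.id (epsF C)) ∘ₗ
      TensorProduct.map (Finsupp.lsingle γ) (Finsupp.lsingle γ))
      (Finsupp.lsingle γ ∘ₗ (TensorProduct.rid k _).toLinearMap ∘ₗ
      (TensorProduct.map LinearMap.id (C.counit γ))) (by intro x y; simp) _

theorem SA_l {a b : G} (h : a + b = 0) (z : BT C 0) :
    TensorProduct.lift (LinearMap.mul k (BT C b))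
      (TensorProduct.map (SA C h) LinearMap.id (DA C h z)) = EA C z • 1 := by
  obtain rfl := eq_neg_of_add_eq_zero_left h
  apply ι_inj
  rw [← lift_nat (μ' := mulF C) (f := ι C b) (g := ι C b) (by intro x y; simp),
    map_sq (f' := SF C (-b)) (g' := LinearMap.id) (p' := ι C (-b)) (q' := ι C b)
      (by intro x; simp) (by intro x; simp)]
  change TensorProduct.lift (mulF C) (TensorProduct.map (SF C (-b)) LinearMap.id
    (ι2 C (-b) b (DA C h z))) = _
  rw [ι2_DA, map_smul, EA_apply, ι_one]
  refine Bs_lin C (TensorProduct.lift (mulF C) ∘ₗ TensorProduct.map (SF C (-b)) LinearMap.id ∘ₗ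
    comulF C (-b) b) ((epsF C).smulRight _) ?_ (ι_mem C z)
  intro γ x hx
  simp only [LinearMap.comp_apply, comulF_single, LinearMap.smulRight_apply, epsF_single]
  rw [map_sq (f' := Finsupp.lsingle (-γ)) (g' := Finsupp.lsingle γ) (p' := C.S (-b) γ)
    (q' := LinearMap.id) (by simp) (by simp),
    lift_nat (μ := C.mul) (e := Finsupp.lsingle 0) (by simp), C.antipode_left b γ x hx]
  simp

theorem SA_r {a b : G} (h : a + b = 0) (h' : b + a = 0) (z : BT C 0) :
    TensorProduct.lift (LinearMap.mul k (BT C b))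
      (TensorProduct.map LinearMap.id (SA C h) (DA C h' z)) = EA C z • 1 := by
  obtain rfl := eq_neg_of_add_eq_zero_left h
  apply ι_inj
  rw [← lift_nat (μ' := mulF C) (f := ι C b) (g := ι C b) (by intro x y; simp),
    map_sq (f' := LinearMap.id) (g' := SF C (-b)) (p' := ι C b) (q' := ι C (-b))
      (by intro x; simp) (by intro x; simp)]
  change TensorProduct.lift (mulF C) (TensorProduct.map LinearMap.id (SF C (-b))
    (ι2 C b (-b) (DA C h' z))) = _
  rw [ι2_DA, map_smul, EA_apply, ι_one]
  refine Bs_lin C (TensorProduct.lift (mulF C) ∘ₗ TensorProduct.map LinearMap.id (SF C (-b)) ∘ₗ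
    comulF C b (-b)) ((epsF C).smulRight _) ?_ (ι_mem C z)
  intro γ x hx
  simp only [LinearMap.comp_apply, comulF_single, LinearMap.smulRight_apply, epsF_single]
  rw [map_sq (f' := Finsupp.lsingle γ) (g' := Finsupp.lsingle (-γ)) (p' := LinearMap.id)
    (q' := C.S (-b) γ) (by simp) (by simp),
    lift_nat (μ := C.mul) (e := Finsupp.lsingle 0) (by simp), C.antipode_right b γ x hx]
  simp

end H
end PivAux

namespace PivAux
open TensorProduct

section RH
variable {k G : Type*} [Field k] [CommRing G] [Invertible (2 : G)] (Hb : RibbonHopfGBialgebra k G)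

theorem half_add (a b : G) : ⅟(2 : G) * a + ⅟(2 : G) * b = ⅟(2 : G) * (a + b) := (mul_add _ _ _).symm

theorem half_half (a : G) : ⅟(2 : G) * a + ⅟(2 : G) * a = a := by
  rw [← two_mul, mul_invOf_cancel_left]

/-- totalized inverse antipode -/
noncomputable def SinvF (a : G) : (G →₀ Hb.A) →ₗ[k] (G →₀ Hb.A) :=
  Finsupp.lsum k (fun γ => Finsupp.lsingle (-γ) ∘ₗ Hb.Sinv a (-γ))

theorem SA_inj {a b : G} (h : a + b = 0) (x y : BT Hb.toHopfGBialgebra a) (hxy : SA Hb.toHopfGBialgebra h x = SA Hb.toHopfGBialgebra h y) :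
    x = y := by
  apply ι_inj
  have key : ∀ x : BT Hb.toHopfGBialgebra a, SinvF Hb a (SF Hb.toHopfGBialgebra a (ι Hb.toHopfGBialgebra a x)) = ι Hb.toHopfGBialgebra a x := fun x =>
    Bs_lin Hb.toHopfGBialgebra (SinvF Hb a ∘ₗ SF Hb.toHopfGBialgebra a) LinearMap.id (by
      intro γ x hx
      simp [SinvF, Hb.Sinv_S a γ x hx]) (ι_mem Hb.toHopfGBialgebra x)
  rw [← key x, ← key y, ← ι_SA Hb.toHopfGBialgebra h x, hxy, ι_SA]

/-- totalized R-matrix -/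
noncomputable def RB (a b : G) : BT Hb.toHopfGBialgebra a ⊗[k] BT Hb.toHopfGBialgebra b :=
  (range_aux Hb.toHopfGBialgebra (Hb.R_mem a b)).choose

theorem ι2_RB (a b : G) : ι2 Hb.toHopfGBialgebra a b (RB Hb a b) =
    TensorProduct.map (Finsupp.lsingle (⅟(2 : G) * b)) (Finsupp.lsingle (⅟(2 : G) * a)) (Hb.R a b) :=
  (range_aux Hb.toHopfGBialgebra (Hb.R_mem a b)).choose_spec

theorem RB1 {a b c : G} (h : a + b = c) (h' : b + a = c) (x : BT Hb.toHopfGBialgebra c) :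
    RB Hb a b * DA Hb.toHopfGBialgebra h x = (TensorProduct.comm k _ _ (DA Hb.toHopfGBialgebra h' x)) * RB Hb a b := by
  subst h
  apply ι2_inj
  rw [ι2_mul, ι2_mul]
  have hc : ι2 Hb.toHopfGBialgebra a b (TensorProduct.comm k _ _ (DA Hb.toHopfGBialgebra h' x)) =
      TensorProduct.comm k _ _ (comulF Hb.toHopfGBialgebra b a (ι Hb.toHopfGBialgebra (a + b) x)) := by
    rw [← ι2_DA Hb.toHopfGBialgebra h']; exact (comm_nat _ _ _).symm
  rw [hc, ι2_DA, ι2_RB]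
  refine Bs_lin Hb.toHopfGBialgebra (tmulMul (mulF Hb.toHopfGBialgebra) (mulF Hb.toHopfGBialgebra) _ ∘ₗ comulF Hb.toHopfGBialgebra a b)
    ((tmulMul (mulF Hb.toHopfGBialgebra) (mulF Hb.toHopfGBialgebra)).flip _ ∘ₗ (TensorProduct.comm k _ _).toLinearMap ∘ₗ
      comulF Hb.toHopfGBialgebra b a) ?_ (ι_mem Hb.toHopfGBialgebra x)
  intro γ x hx
  simp only [LinearMap.comp_apply, comulF_single, LinearMap.flip_apply, LinearEquiv.coe_coe,
    comm_nat]
  rw [← tm_single, ← tm_single, Hb.R_comul a b γ x hx, add_comm γ, add_comm γ]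

theorem RB2 {a b c d : G} (h : b + c = d) :
    TensorProduct.map LinearMap.id (DA Hb.toHopfGBialgebra h).toLinearMap (RB Hb a d) =
      (TensorProduct.map (TensorProduct.lift (LinearMap.mul k (BT Hb.toHopfGBialgebra a)))
        (TensorProduct.comm k _ _).toLinearMap)
        (TensorProduct.tensorTensorTensorComm k _ _ _ _ (RB Hb a c ⊗ₜ[k] RB Hb a b)) := by
  subst h
  apply ι3_inj
  refine (map_sq (f' := LinearMap.id) (g' := comulF Hb.toHopfGBialgebra b c) (p' := ι Hb.toHopfGBialgebra a) (q' := ι Hb.toHopfGBialgebra (b + c))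
    (by simp) (by intro x; exact ι2_DA Hb.toHopfGBialgebra rfl x) _).trans ?_
  refine (congrArg _ (ι2_RB Hb a (b + c))).trans ?_
  rw [map_sq (f' := Finsupp.lsingle (⅟(2 : G) * (b + c)))
    (g' := TensorProduct.map (Finsupp.lsingle (⅟(2 : G) * a)) (Finsupp.lsingle (⅟(2 : G) * a)))
    (p' := LinearMap.id) (q' := Hb.comul b c) (by simp) (by simp), Hb.comul_R_right]
  have e1 := ι2_RB Hb a c
  have e2 := ι2_RB Hb a b
  symm
  refine (map_sq (f' := TensorProduct.lift (mulF Hb.toHopfGBialgebra)) (g' := (TensorProduct.comm k _ _).toLinearMap)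
    (p' := TensorProduct.map (ι Hb.toHopfGBialgebra a) (ι Hb.toHopfGBialgebra a)) (q' := TensorProduct.map (ι Hb.toHopfGBialgebra c) (ι Hb.toHopfGBialgebra b))
    (by intro x; exact (lift_nat (by intro x y; simp) x).symm)
    (by intro x; exact (comm_nat _ _ x).symm) _).trans ?_
  rw [← ttt_nat, TensorProduct.map_tmul]
  change TensorProduct.map _ _ (TensorProduct.tensorTensorTensorComm k _ _ _ _
    (ι2 Hb.toHopfGBialgebra a c (RB Hb a c) ⊗ₜ ι2 Hb.toHopfGBialgebra a b (RB Hb a b))) = _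
  rw [e1, e2, ← TensorProduct.map_tmul, ttt_nat]
  refine map_sq (fun x => ?_) (fun x => ?_) _
  · exact lift_nat (by intro x y; simp [half_add, add_comm]) x
  · exact comm_nat _ _ x

theorem RB3 {a b c d : G} (h : a + b = d) :
    TensorProduct.map (DA Hb.toHopfGBialgebra h).toLinearMap LinearMap.id (RB Hb d c) =
      (TensorProduct.map LinearMap.id (TensorProduct.lift (LinearMap.mul k (BT Hb.toHopfGBialgebra c))))
        (TensorProduct.tensorTensorTensorComm k _ _ _ _ (RB Hb a c ⊗ₜ[k] RB Hb b c)) := by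
  subst h
  apply map_inj' _ _ (ι2_inj Hb.toHopfGBialgebra a b) (ι_inj Hb.toHopfGBialgebra c)
  refine (map_sq (f' := comulF Hb.toHopfGBialgebra a b) (g' := LinearMap.id) (p' := ι Hb.toHopfGBialgebra (a + b)) (q' := ι Hb.toHopfGBialgebra c)
    (by intro x; exact ι2_DA Hb.toHopfGBialgebra rfl x) (by simp) _).trans ?_
  refine (congrArg _ (ι2_RB Hb (a + b) c)).trans ?_
  rw [map_sq (g' := Finsupp.lsingle (⅟(2 : G) * (a + b)))
    (f' := TensorProduct.map (Finsupp.lsingle (⅟(2 : G) * c)) (Finsupp.lsingle (⅟(2 : G) * c)))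
    (q' := LinearMap.id) (p' := Hb.comul a b) (by simp) (by simp), Hb.comul_R_left]
  have e1 := ι2_RB Hb a c
  have e2 := ι2_RB Hb b c
  symm
  refine (map_sq (g' := TensorProduct.lift (mulF Hb.toHopfGBialgebra)) (f' := LinearMap.id)
    (p' := TensorProduct.map (ι Hb.toHopfGBialgebra a) (ι Hb.toHopfGBialgebra b)) (q' := TensorProduct.map (ι Hb.toHopfGBialgebra c) (ι Hb.toHopfGBialgebra c))
    (by intro x; rfl)
    (by intro x; exact (lift_nat (by intro x y; simp) x).symm) _).trans ?_
  rw [← ttt_nat, TensorProduct.map_tmul]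
  change TensorProduct.map _ _ (TensorProduct.tensorTensorTensorComm k _ _ _ _
    (ι2 Hb.toHopfGBialgebra a c (RB Hb a c) ⊗ₜ ι2 Hb.toHopfGBialgebra b c (RB Hb b c))) = _
  rw [e1, e2, ← TensorProduct.map_tmul, ttt_nat]
  refine map_sq (fun x => ?_) (fun x => ?_) _
  · rfl
  · exact lift_nat (by intro x y; simp [half_add]) x

/-- totalized ribbon element -/
noncomputable def vB (a : G) : BT Hb.toHopfGBialgebra a := (range_ι Hb.toHopfGBialgebra a (single_mem Hb.toHopfGBialgebra (Hb.v_mem a))).choose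
theorem ι_vB (a : G) : ι Hb.toHopfGBialgebra a (vB Hb a) = Finsupp.single (-a) (Hb.v a) :=
  (range_ι Hb.toHopfGBialgebra a (single_mem Hb.toHopfGBialgebra (Hb.v_mem a))).choose_spec

/-- totalized inverse ribbon element -/
noncomputable def wB (a : G) : BT Hb.toHopfGBialgebra a := (range_ι Hb.toHopfGBialgebra a (single_mem Hb.toHopfGBialgebra (Hb.vinv_mem a))).choose
theorem ι_wB (a : G) : ι Hb.toHopfGBialgebra a (wB Hb a) = Finsupp.single a (Hb.vinv a) :=
  (range_ι Hb.toHopfGBialgebra a (single_mem Hb.toHopfGBialgebra (Hb.vinv_mem a))).choose_spec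

/-- totalized Drinfeld element -/
noncomputable def uB (a : G) : BT Hb.toHopfGBialgebra a := TensorProduct.lift (LinearMap.mul k (BT Hb.toHopfGBialgebra a))
    (TensorProduct.map (SA Hb.toHopfGBialgebra (neg_add_cancel a)) LinearMap.id
      (TensorProduct.comm k _ _ (RB Hb a (-a))))

theorem ι_uB (a : G) : ι Hb.toHopfGBialgebra a (uB Hb a) = Finsupp.single (-a)
    (drinfeldAux Hb.mul (Hb.S (-a) (⅟(2 : G) * a)) (Hb.R a (-a))) := by
  unfold uB drinfeldAux
  rw [← lift_nat (μ' := mulF Hb.toHopfGBialgebra) (f := ι Hb.toHopfGBialgebra a) (g := ι Hb.toHopfGBialgebra a) (by intro x y; simp),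
    map_sq (f' := SF Hb.toHopfGBialgebra (-a)) (g' := LinearMap.id) (p' := ι Hb.toHopfGBialgebra (-a)) (q' := ι Hb.toHopfGBialgebra a)
      (by intro x; simp) (by intro x; simp), ← comm_nat]
  have e := ι2_RB Hb a (-a)
  unfold ι2 at e
  rw [e, comm_nat, map_sq (f' := Finsupp.lsingle (-(⅟(2 : G) * a)))
    (g' := Finsupp.lsingle (⅟(2 : G) * (-a))) (p' := Hb.S (-a) (⅟(2 : G) * a))
    (q' := LinearMap.id) (by simp) (by simp),
    lift_nat (μ := Hb.mul) (e := Finsupp.lsingle (-a))]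
  · rfl
  · intro x y
    have : -(⅟(2 : G) * a) + ⅟(2 : G) * (-a) = -a := by
      rw [mul_neg, ← neg_add, half_half]
    simp only [Finsupp.lsingle_apply, mulF_single, this]

theorem v_sqB (a : G) : vB Hb a * vB Hb a = uB Hb a * SA Hb.toHopfGBialgebra (neg_add_cancel a) (uB Hb (-a)) := by
  apply ι_inj
  rw [ι_mul, ι_mul, ι_SA, ι_vB, ι_uB, ι_uB, SF_single, mulF_single, mulF_single, Hb.v_sq]
  simp only [neg_neg]

theorem Δ_vB {a b c : G} (h : a + b = c) : DA Hb.toHopfGBialgebra h (vB Hb c) =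
    (TensorProduct.map
        ((LinearMap.mul k (BT Hb.toHopfGBialgebra a) (vB Hb a)) ∘ₗ
          (TensorProduct.lift (LinearMap.mul k (BT Hb.toHopfGBialgebra a))) ∘ₗ
          (TensorProduct.map (SA Hb.toHopfGBialgebra (neg_add_cancel a)) LinearMap.id))
        ((LinearMap.mul k (BT Hb.toHopfGBialgebra b) (vB Hb b)) ∘ₗ
          (TensorProduct.lift (LinearMap.mul k (BT Hb.toHopfGBialgebra b))) ∘ₗ
          (TensorProduct.map LinearMap.id (SA Hb.toHopfGBialgebra (neg_add_cancel b)))))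
        ((TensorProduct.tensorTensorTensorComm k _ _ _ _)
          (RB Hb (-a) b ⊗ₜ[k] (TensorProduct.comm k _ _) (RB Hb (-b) a))) := by
  subst h
  apply ι2_inj
  rw [ι2_DA, ι_vB, comulF_single, Hb.comul_v]
  have e1 := ι2_RB Hb (-a) b
  have e2 := ι2_RB Hb (-b) a
  have d1 : -a + (-(⅟(2 : G) * b) + ⅟(2 : G) * (-b)) = -(a + b) := by
    rw [mul_neg, ← neg_add, half_half, neg_add]
  have d2 : -b + (⅟(2 : G) * (-a) + -(⅟(2 : G) * a)) = -(a + b) := by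
    rw [mul_neg, ← neg_add, half_half, neg_add, add_comm]
  symm
  refine (map_sq (f' := mulF Hb.toHopfGBialgebra (Finsupp.single (-a) (Hb.v a)) ∘ₗ TensorProduct.lift (mulF Hb.toHopfGBialgebra) ∘ₗ
      TensorProduct.map (SF Hb.toHopfGBialgebra (-a)) LinearMap.id)
    (g' := mulF Hb.toHopfGBialgebra (Finsupp.single (-b) (Hb.v b)) ∘ₗ TensorProduct.lift (mulF Hb.toHopfGBialgebra) ∘ₗ
      TensorProduct.map LinearMap.id (SF Hb.toHopfGBialgebra (-b)))
    (p' := TensorProduct.map (ι Hb.toHopfGBialgebra (-a)) (ι Hb.toHopfGBialgebra a)) (q' := TensorProduct.map (ι Hb.toHopfGBialgebra b) (ι Hb.toHopfGBialgebra (-b)))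
    (fun x => ?_) (fun x => ?_) _).trans ?_
  · refine ext2 (ι Hb.toHopfGBialgebra a ∘ₗ ((LinearMap.mul k (BT Hb.toHopfGBialgebra a) (vB Hb a)) ∘ₗ
          (TensorProduct.lift (LinearMap.mul k (BT Hb.toHopfGBialgebra a))) ∘ₗ
          (TensorProduct.map (SA Hb.toHopfGBialgebra (neg_add_cancel a)) LinearMap.id)))
        ((mulF Hb.toHopfGBialgebra (Finsupp.single (-a) (Hb.v a)) ∘ₗ TensorProduct.lift (mulF Hb.toHopfGBialgebra) ∘ₗ
      TensorProduct.map (SF Hb.toHopfGBialgebra (-a)) LinearMap.id) ∘ₗ TensorProduct.map (ι Hb.toHopfGBialgebra (-a)) (ι Hb.toHopfGBialgebra a))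
      (fun x y => ?_) x
    simp [ι_vB]
  · refine ext2 (ι Hb.toHopfGBialgebra b ∘ₗ ((LinearMap.mul k (BT Hb.toHopfGBialgebra b) (vB Hb b)) ∘ₗ
          (TensorProduct.lift (LinearMap.mul k (BT Hb.toHopfGBialgebra b))) ∘ₗ
          (TensorProduct.map LinearMap.id (SA Hb.toHopfGBialgebra (neg_add_cancel b)))))
        ((mulF Hb.toHopfGBialgebra (Finsupp.single (-b) (Hb.v b)) ∘ₗ TensorProduct.lift (mulF Hb.toHopfGBialgebra) ∘ₗ
      TensorProduct.map LinearMap.id (SF Hb.toHopfGBialgebra (-b))) ∘ₗ TensorProduct.map (ι Hb.toHopfGBialgebra b) (ι Hb.toHopfGBialgebra (-b)))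
      (fun x y => ?_) x
    simp [ι_vB]
  rw [← ttt_nat, TensorProduct.map_tmul, ← comm_nat]
  unfold ι2 at e1 e2
  rw [e1, e2, comm_nat, ← TensorProduct.map_tmul, ttt_nat]
  refine map_sq (fun x => ?_) (fun x => ?_) _
  · refine ext2 ((mulF Hb.toHopfGBialgebra (Finsupp.single (-a) (Hb.v a)) ∘ₗ TensorProduct.lift (mulF Hb.toHopfGBialgebra) ∘ₗ
      TensorProduct.map (SF Hb.toHopfGBialgebra (-a)) LinearMap.id) ∘ₗ
        TensorProduct.map (Finsupp.lsingle (⅟(2 : G) * b)) (Finsupp.lsingle (⅟(2 : G) * (-b))))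
      (Finsupp.lsingle (-(a + b)) ∘ₗ ((Hb.mul (Hb.v a)) ∘ₗ (TensorProduct.lift Hb.mul) ∘ₗ
          (TensorProduct.map (Hb.S (-a) (⅟(2 : G) * b)) LinearMap.id))) (fun x y => ?_) x
    simp only [LinearMap.comp_apply, TensorProduct.map_tmul, TensorProduct.lift.tmul,
      Finsupp.lsingle_apply, SF_single, LinearMap.id_apply, mulF_single, d1]
  · refine ext2 ((mulF Hb.toHopfGBialgebra (Finsupp.single (-b) (Hb.v b)) ∘ₗ TensorProduct.lift (mulF Hb.toHopfGBialgebra) ∘ₗ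
      TensorProduct.map LinearMap.id (SF Hb.toHopfGBialgebra (-b))) ∘ₗ
        TensorProduct.map (Finsupp.lsingle (⅟(2 : G) * (-a))) (Finsupp.lsingle (⅟(2 : G) * a)))
      (Finsupp.lsingle (-(a + b)) ∘ₗ ((Hb.mul (Hb.v b)) ∘ₗ (TensorProduct.lift Hb.mul) ∘ₗ
          (TensorProduct.map LinearMap.id (Hb.S (-b) (⅟(2 : G) * a))))) (fun x y => ?_) x
    simp only [LinearMap.comp_apply, TensorProduct.map_tmul, TensorProduct.lift.tmul,
      Finsupp.lsingle_apply, SF_single, LinearMap.id_apply, mulF_single, d2]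

/-- the totalized ribbon structure -/
noncomputable def totalTH : TH k (BT Hb.toHopfGBialgebra) where
  Δ := fun h => DA Hb.toHopfGBialgebra h
  ε := EA Hb.toHopfGBialgebra
  S := fun h => SA Hb.toHopfGBialgebra h
  coassoc := DA_coassoc Hb.toHopfGBialgebra
  counit_l := DA_counit_l Hb.toHopfGBialgebra
  counit_r := DA_counit_r Hb.toHopfGBialgebra
  S_l := SA_l Hb.toHopfGBialgebra
  S_r := SA_r Hb.toHopfGBialgebra
  S_inj := SA_inj Hb
  R := RB Hb
  R1 := RB1 Hb
  R2 := RB2 Hb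
  R3 := RB3 Hb
  v := vB Hb
  vinv := wB Hb
  v_vinv := fun a => ι_inj Hb.toHopfGBialgebra a (by
    rw [ι_mul, ι_vB, ι_wB, mulF_single, neg_add_cancel, Hb.v_vinv, ι_one])
  vinv_v := fun a => ι_inj Hb.toHopfGBialgebra a (by
    rw [ι_mul, ι_vB, ι_wB, mulF_single, add_neg_cancel, Hb.vinv_v, ι_one])
  u := uB Hb
  u_eq := fun a => rfl
  v_sq := v_sqB Hb
  Δ_v := Δ_vB Hb

theorem ι_g (a : G) : ι Hb.toHopfGBialgebra a (uB Hb a * wB Hb a) = Finsupp.single 0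
    (Hb.mul (drinfeldAux Hb.mul (Hb.S (-a) (⅟(2 : G) * a)) (Hb.R a (-a))) (Hb.vinv a)) := by
  rw [ι_mul, ι_uB, ι_wB, mulF_single, neg_add_cancel]

end RH
end PivAux

/-- (R14) and (R15): the pivotal element `g_α = u_α^{-α} (v^{-1})_α^α` is grouplike:
`Δ_{α,β}(g_{α+β}) = g_α ⊗ g_β` and `ε^0(g_0) = 1`. -/
theorem RibbonHopfGBialgebra.pivotal_grouplike {k G : Type*} [Field k] [CommRing G]
    [Invertible (2 : G)] (Hb : RibbonHopfGBialgebra k G) (α β : G) :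
    let g : G → Hb.A := fun δ =>
      Hb.mul (drinfeldAux Hb.mul (Hb.S (-δ) (⅟(2 : G) * δ)) (Hb.R δ (-δ))) (Hb.vinv δ)
    Hb.comul α β (g (α + β)) = g α ⊗ₜ[k] g β ∧ Hb.counit 0 (g 0) = 1 := by
  intro g
  have hg : ∀ a, PivAux.ι Hb.toHopfGBialgebra a (PivAux.uB Hb a * PivAux.wB Hb a) =
    Finsupp.single 0 (g a) := PivAux.ι_g Hb
  constructor
  · have h1 : PivAux.DA Hb.toHopfGBialgebra (rfl : α + β = α + β)
        (PivAux.uB Hb (α + β) * PivAux.wB Hb (α + β)) =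
        (PivAux.uB Hb α * PivAux.wB Hb α) ⊗ₜ (PivAux.uB Hb β * PivAux.wB Hb β) :=
      (PivAux.totalTH Hb).grouplike rfl
    have h2 := congrArg (PivAux.ι2 Hb.toHopfGBialgebra α β) h1
    rw [PivAux.ι2_DA, PivAux.ι2_tmul, hg, hg, hg, PivAux.comulF_single] at h2
    exact PivAux.map_inj' (Finsupp.lsingle 0) (Finsupp.lsingle 0)
      (Finsupp.single_injective 0) (Finsupp.single_injective 0) h2
  · have h1 : PivAux.EA Hb.toHopfGBialgebra (PivAux.uB Hb 0 * PivAux.wB Hb 0) = 1 :=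
      (PivAux.totalTH Hb).counit_g
    rw [PivAux.EA_apply, hg, PivAux.epsF_single] at h1
    exact h1
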